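/- arXiv:1810.12616 — 11 statements merged into one kernel-verified Lean document; each statement's English description precedes it below -/
import Mathlib

section
/- Let n and d be nonzero coprime polynomials with real coefficients such that s^2 divides d (so that the loop transfer function R(s) = n(s)/d(s) has a pole of order at least 2 at s = 0) and deg n ≤ deg d. Assume every root of the polynomial d + n has strictly negative real part, and set T(s) = n(s)/(d(s) + n(s)). Then the integral ∫₀^∞ ln|T(iω)| ω⁻² dω converges and equals π · Σ_k Re(1/q_k), where the sum runs over the roots q_k of n with strictly positive real part, counted with multiplicity; in particular ∫₀^∞ ln|T(iω)| ω⁻² dω ≥ 0. -/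
open Polynomial MeasureTheory Complex Set

section
open Filter Topology

lemma bode_ftc (g g' : ℝ → ℝ) (s : Set ℝ) (hs : s.Countable) (L : ℝ)
    (h0 : g 0 = 0) (h0' : HasDerivAt g 0 0) (hc : Continuous g)
    (hd : ∀ x, 0 < x → x ∉ s → HasDerivAt g (g' x) x)
    (hL : Tendsto (fun x => -(g x / x)) atTop (𝓝 L))
    (hi : IntegrableOn (fun x => (g x - x * g' x) / x ^ 2) (Ioi 0)) :
    ∫ x in Ioi (0 : ℝ), (g x - x * g' x) / x ^ 2 = L := by
  have hcont : Continuous (fun x => -(g x / x)) := by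
    rw [continuous_iff_continuousAt]
    intro x
    by_cases hx : x = 0
    · subst hx
      rw [hasDerivAt_iff_tendsto_slope] at h0'
      rw [continuousAt_iff_punctured_nhds]
      have : (fun x => -(g x / x)) = fun x => -(slope g 0 x) := by
        ext x; simp [slope_def_field, h0]
      simpa [this, slope_def_field] using h0'.neg
    · exact (hc.continuousAt.div continuousAt_id hx).neg
  have h1 : ∀ R : ℝ, 0 < R → ∫ x in (0:ℝ)..R, (g x - x * g' x) / x ^ 2 = -(g R / R) := by
    intro R hR
    have := integral_eq_of_hasDerivAt_off_countable_of_le (fun x => -(g x / x))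
      (fun x => (g x - x * g' x) / x ^ 2) hR.le hs hcont.continuousOn ?_ ?_
    · simpa using this
    · rintro x ⟨hx, hxs⟩
      have := ((hd x hx.1 hxs).div (hasDerivAt_id x) hx.1.ne').neg
      refine this.congr_deriv ?_
      simp; ring
    · rw [intervalIntegrable_iff_integrableOn_Ioc_of_le hR.le]
      exact hi.mono_set Ioc_subset_Ioi_self
  have h2 := intervalIntegral_tendsto_integral_Ioi 0 hi tendsto_id
  refine tendsto_nhds_unique h2 (hL.congr' ?_)
  filter_upwards [eventually_gt_atTop 0] with R hR
  exact (h1 R hR).symm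

/-- asymptotics at infinity -/
lemma bode_bound (a : ℂ) (ha : a ≠ 0) : ∃ C : ℝ, ∀ᶠ x : ℝ in atTop,
    |Real.log ‖1 + a * (x : ℂ) ^ 2‖| ≤ C * x ^ (1/2 : ℝ) := by
  have h1 : Tendsto (fun x : ℝ => Real.log ‖((x⁻¹ : ℝ) : ℂ) ^ 2 + a‖) atTop (𝓝 (Real.log ‖a‖)) := by
    have : Tendsto (fun x : ℝ => ((x⁻¹ : ℝ) : ℂ) ^ 2 + a) atTop (𝓝 a) := by
      have h := ((Complex.continuous_ofReal.tendsto 0).comp tendsto_inv_atTop_zero).pow 2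
      simpa using h.add_const a
    exact (this.norm).log (by simpa using ha)
  have h2 := (isLittleO_log_rpow_atTop (r := 1/2) (by norm_num)).bound (c := 1) one_pos
  have h3 := h1.abs.eventually_lt_const (lt_add_one _)
  have h4 : ∀ᶠ x : ℝ in atTop, ((x⁻¹ : ℝ) : ℂ) ^ 2 + a ≠ 0 := by
    have : Tendsto (fun x : ℝ => ((x⁻¹ : ℝ) : ℂ) ^ 2 + a) atTop (𝓝 a) := by
      have h := ((Complex.continuous_ofReal.tendsto 0).comp tendsto_inv_atTop_zero).pow 2
      simpa using h.add_const a
    exact this.eventually_ne ha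
  refine ⟨2 + (|Real.log ‖a‖| + 1), ?_⟩
  filter_upwards [h2, h3, h4, eventually_ge_atTop 1] with x h2 h3 h4 hx
  have hx0 : (x : ℂ) ≠ 0 := by exact_mod_cast (by linarith : x ≠ 0)
  have e : 1 + a * (x : ℂ) ^ 2 = (x : ℂ) ^ 2 * (((x⁻¹ : ℝ) : ℂ) ^ 2 + a) := by
    push_cast; field_simp
  rw [e, norm_mul, Real.log_mul (by simpa using (by linarith : x ≠ 0)) (by simpa using h4), norm_pow, Real.log_pow]
  have h5 : 1 ≤ x ^ (1/2 : ℝ) := Real.one_le_rpow hx (by norm_num)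
  have h6 : ‖(x : ℂ)‖ = x := by simp; linarith
  rw [h6]
  simp only [Real.norm_eq_abs, one_mul] at h2
  rw [abs_of_nonneg (by positivity : 0 ≤ x ^ (1/2 : ℝ))] at h2
  refine (abs_add_le _ _).trans ?_
  rw [abs_mul]
  norm_num at *
  nlinarith [abs_nonneg (Real.log ‖a‖)]

lemma bode_integrable (a : ℂ) (ha : a ≠ 0) :
    IntegrableOn (fun x : ℝ => Real.log ‖1 + a * (x : ℂ) ^ 2‖ / x ^ 2) (Ioi 0) := by
  have hmeas : Measurable (fun x : ℝ => Real.log ‖1 + a * (x : ℂ) ^ 2‖ / x ^ 2) := by fun_prop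
  obtain ⟨C, hC⟩ := bode_bound a ha
  obtain ⟨M, hM⟩ := eventually_atTop.1 hC
  have hev : ∀ᶠ x : ℝ in 𝓝 0, ‖a * (x : ℂ) ^ 2‖ < 1 / 2 := by
    have : Tendsto (fun x : ℝ => ‖a * (x : ℂ) ^ 2‖) (𝓝 0) (𝓝 ‖a * ((0:ℝ) : ℂ) ^ 2‖) :=
      (by fun_prop : Continuous (fun x : ℝ => ‖a * (x : ℂ) ^ 2‖)).tendsto 0
    exact this.eventually_lt_const (by simp)
  obtain ⟨δ, hδ, hδ'⟩ := Metric.eventually_nhds_iff.1 hev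
  set ε := δ / 2 with hε
  have hεpos : 0 < ε := by positivity
  set N := max M (max ε 1) with hN
  have hMN : M ≤ N := le_max_left _ _
  have hεN : ε ≤ N := (le_max_left _ _).trans (le_max_right _ _)
  have h1N : 1 ≤ N := (le_max_right _ _).trans (le_max_right _ _)
  have hsplit : Ioi (0:ℝ) = Ioc 0 ε ∪ (Ioc ε N ∪ Ioi N) := by
    rw [Ioc_union_Ioi_eq_Ioi hεN, Ioc_union_Ioi_eq_Ioi hεpos.le]
  rw [hsplit]
  refine IntegrableOn.union ?_ (IntegrableOn.union ?_ ?_)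
  · refine Measure.integrableOn_of_bounded (M := 3 / 2 * ‖a‖) (by simp) hmeas.aestronglyMeasurable ?_
    rw [ae_restrict_iff' measurableSet_Ioc]
    refine ae_of_all _ fun x hx => ?_
    have hxx : ‖a * (x : ℂ) ^ 2‖ < 1 / 2 := hδ' (by
      simp [abs_of_pos hx.1]; linarith [hx.2])
    have := norm_log_one_add_half_le_self hxx.le
    have h2 : |Real.log ‖1 + a * (x : ℂ) ^ 2‖| ≤ 3 / 2 * ‖a * (x : ℂ) ^ 2‖ := by
      rw [← Complex.log_re]
      exact (Complex.abs_re_le_norm _).trans this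
    have hx2 : 0 < x ^ 2 := by have := hx.1; positivity
    rw [norm_div, Real.norm_eq_abs, Real.norm_eq_abs, abs_of_pos hx2, div_le_iff₀ hx2]
    refine h2.trans (le_of_eq ?_)
    simp; ring
  · have := MeromorphicOn.intervalIntegrable_log_norm (a := ε) (b := N)
      (f := fun x : ℝ => 1 + a * (x : ℂ) ^ 2) ?_
    · rw [← intervalIntegrable_iff_integrableOn_Ioc_of_le hεN]
      simp only [div_eq_mul_inv]
      refine this.mul_continuousOn ?_
      refine ContinuousOn.inv₀ (by fun_prop) ?_
      intro x hx
      rw [uIcc_of_le hεN] at hx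
      have : 0 < x := hεpos.trans_le hx.1
      positivity
    · intro x _
      apply AnalyticAt.meromorphicAt
      have : AnalyticAt ℝ (fun x : ℝ => (x : ℂ)) x := Complex.ofRealCLM.analyticAt x
      fun_prop
  · have hint := (integrableOn_Ioi_rpow_of_lt (a := -3/2) (by norm_num) (by linarith : 0 < N)).const_mul C
    refine Integrable.mono' hint hmeas.aestronglyMeasurable ?_
    rw [ae_restrict_iff' measurableSet_Ioi]
    refine ae_of_all _ fun x hx => ?_
    have hx : N < x := hx
    have hx0 : 0 < x := by linarith
    have := hM x (by linarith)
    have hx2 : 0 < x ^ 2 := by positivity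
    rw [norm_div, Real.norm_eq_abs, Real.norm_eq_abs, abs_of_pos hx2, div_le_iff₀ hx2]
    refine this.trans (le_of_eq ?_)
    rw [mul_assoc, ← Real.rpow_natCast, ← Real.rpow_add hx0]
    norm_num

lemma bode_log_div (a : ℂ) (ha : a ≠ 0) :
    Tendsto (fun x : ℝ => Real.log ‖1 + a * (x : ℂ) ^ 2‖ / x) atTop (𝓝 0) := by
  obtain ⟨C, hC⟩ := bode_bound a ha
  have h := (tendsto_rpow_neg_atTop (y := 1/2) (by norm_num)).const_mul C
  rw [mul_zero] at h
  refine squeeze_zero_norm' ?_ h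
  filter_upwards [hC, eventually_gt_atTop 0] with x hx hx0
  rw [norm_div, Real.norm_eq_abs, Real.norm_eq_abs, abs_of_pos hx0, div_le_iff₀ hx0]
  refine hx.trans (le_of_eq ?_)
  rw [mul_assoc, ← Real.rpow_add_one hx0.ne']
  norm_num

/-- imaginary case -/
lemma bode_imag (b : ℝ) (hb : b ≠ 0) :
    ∫ x in Ioi (0 : ℝ), Real.log ‖1 + (I * b) ^ 2 * (x : ℂ) ^ 2‖ / x ^ 2 = 0 := by
  have hne : (I * b : ℂ) ^ 2 ≠ 0 := by simp [hb]
  set s : Set ℝ := {b⁻¹, -b⁻¹} with hs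
  have hns : ∀ x : ℝ, x ∉ s → 1 - b * x ≠ 0 ∧ 1 + b * x ≠ 0 := by
    intro x hx
    simp only [hs, mem_insert_iff, mem_singleton_iff, not_or] at hx
    refine ⟨fun h => hx.1 ?_, fun h => hx.2 ?_⟩
    · field_simp; linarith
    · field_simp; linarith
  have hlog : ∀ x : ℝ, x ∉ s → Real.log ‖1 + (I * b) ^ 2 * (x : ℂ) ^ 2‖
      = Real.log (1 - b * x) + Real.log (1 + b * x) := by
    intro x hx
    have : (1 + (I * b) ^ 2 * (x : ℂ) ^ 2 : ℂ) = ((1 - b * x) * (1 + b * x) : ℝ) := by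
      push_cast; rw [mul_pow, I_sq]; ring
    rw [this, Complex.norm_real, Real.norm_eq_abs, Real.log_abs,
      Real.log_mul (hns x hx).1 (hns x hx).2]
  set g : ℝ → ℝ := fun x => (1 - b * x) * Real.log (1 - b * x) + (1 + b * x) * Real.log (1 + b * x)
  set g' : ℝ → ℝ := fun x => -b * (Real.log (1 - b * x) + 1) + b * (Real.log (1 + b * x) + 1)
  have hgd : ∀ x, x ∉ s → HasDerivAt g (g' x) x := by
    intro x hx
    have h1 : HasDerivAt (fun x => 1 - b * x) (-b) x := by
      simpa using ((hasDerivAt_id x).const_mul b).const_sub 1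
    have h2 : HasDerivAt (fun x => 1 + b * x) b x := by
      simpa using ((hasDerivAt_id x).const_mul b).const_add 1
    refine (((Real.hasDerivAt_mul_log (hns x hx).1).comp x h1).add
      ((Real.hasDerivAt_mul_log (hns x hx).2).comp x h2)).congr_deriv ?_
    simp only [g']; ring
  have hfg : ∀ x, x ∉ s → Real.log ‖1 + (I * b) ^ 2 * (x : ℂ) ^ 2‖ / x ^ 2
      = (g x - x * g' x) / x ^ 2 := by
    intro x hx
    rw [hlog x hx]; simp only [g, g']; ring
  have hsc : s.Countable := (by simp [hs] : s.Finite).countable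
  have hae : (fun x : ℝ => Real.log ‖1 + (I * b) ^ 2 * (x : ℂ) ^ 2‖ / x ^ 2)
      =ᵐ[volume.restrict (Ioi 0)] fun x => (g x - x * g' x) / x ^ 2 := by
    apply ae_restrict_of_ae
    filter_upwards [hsc.ae_notMem volume] with x hx using hfg x hx
  rw [integral_congr_ae hae]
  have h0s : (0:ℝ) ∉ s := by simp [hs, hb, hb.symm]
  refine bode_ftc g g' s hsc 0 (by simp [g]) ?_ ?_ (fun x _ hx => hgd x hx) ?_ ?_
  · simpa [g'] using hgd 0 h0s
  · exact (Real.continuous_mul_log.comp (by fun_prop : Continuous fun x => 1 - b * x)).add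
      (Real.continuous_mul_log.comp (by fun_prop : Continuous fun x => 1 + b * x))
  · have h1 := bode_log_div _ hne
    have hinv : Tendsto (fun x : ℝ => x⁻¹) atTop (𝓝 0) := tendsto_inv_atTop_zero
    have h2 : Tendsto (fun x : ℝ => b * (Real.log (x⁻¹ - b) - Real.log (x⁻¹ + b))) atTop (𝓝 0) := by
      have ha : Tendsto (fun x : ℝ => Real.log (x⁻¹ - b)) atTop (𝓝 (Real.log (0 - b))) :=
        (hinv.sub_const b).log (by simpa using hb)
      have hb : Tendsto (fun x : ℝ => Real.log (x⁻¹ + b)) atTop (𝓝 (Real.log (0 + b))) :=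
        (hinv.add_const b).log (by simpa using hb)
      have := (ha.sub hb).const_mul b
      simpa using this
    have h3 := h1.neg.add h2
    simp only [neg_zero, add_zero] at h3
    refine h3.congr' ?_
    have hev : ∀ᶠ x : ℝ in atTop, x ∉ s := by
      have : s.Finite := by simp [hs]
      have := this.isCompact.isBounded.bddAbove
      obtain ⟨B, hB⟩ := this
      filter_upwards [eventually_gt_atTop B] with x hx hxs
      exact absurd (hB hxs) (not_le.2 hx)
    filter_upwards [hev, eventually_gt_atTop 0] with x hx hx0
    rw [hlog x hx]
    have e1 : x⁻¹ - b = x⁻¹ * (1 - b * x) := by field_simp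
    have e2 : x⁻¹ + b = x⁻¹ * (1 + b * x) := by field_simp
    rw [e1, e2, Real.log_mul (by positivity) (hns x hx).1, Real.log_mul (by positivity) (hns x hx).2]
    simp only [g]
    field_simp
    ring
  · exact (bode_integrable _ hne).congr_fun_ae hae

lemma bode_pos (c : ℂ) (hc : 0 < c.re) :
    ∫ x in Ioi (0 : ℝ), Real.log ‖1 + c ^ 2 * (x : ℂ) ^ 2‖ / x ^ 2 = Real.pi * c.re := by
  have hc0 : c ≠ 0 := by rintro rfl; simp at hc
  have hne : c ^ 2 ≠ 0 := pow_ne_zero 2 hc0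
  have hp : ∀ x : ℝ, 1 + I * c * x ∈ slitPlane := by
    intro x
    rw [mem_slitPlane_iff]
    by_cases hx : x = 0
    · left; simp [hx]
    · right; simp [hx, hc.ne']
  have hm : ∀ x : ℝ, 1 - I * c * x ∈ slitPlane := by
    intro x
    rw [mem_slitPlane_iff]
    by_cases hx : x = 0
    · left; simp [hx]
    · right; simp [hx, hc.ne']
  set G : ℝ → ℂ := fun x => (1 + I * c * x) * log (1 + I * c * x)
    + (1 - I * c * x) * log (1 - I * c * x)
  set G' : ℝ → ℂ := fun x => I * c * (log (1 + I * c * x) - log (1 - I * c * x))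
  have hGd : ∀ x, HasDerivAt G (G' x) x := by
    intro x
    have h1 : HasDerivAt (fun x : ℝ => 1 + I * c * (x:ℂ)) (I * c) x := by
      simpa using ((Complex.ofRealCLM.hasDerivAt (x := x)).const_mul (I * c)).const_add 1
    have h2 : HasDerivAt (fun x : ℝ => 1 - I * c * (x:ℂ)) (-(I * c)) x := by
      simpa using ((Complex.ofRealCLM.hasDerivAt (x := x)).const_mul (I * c)).const_sub 1
    refine ((h1.mul (h1.clog_real (hp x))).add (h2.mul (h2.clog_real (hm x)))).congr_deriv ?_
    have := slitPlane_ne_zero (hp x)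
    have := slitPlane_ne_zero (hm x)
    simp only [G']
    field_simp
    ring
  have hgd : ∀ x, HasDerivAt (fun x => (G x).re) (G' x).re x := fun x => by
    have := (Complex.reCLM.hasFDerivAt (x := G x)).comp_hasDerivAt x (hGd x)
    simpa [Function.comp_def] using this
  have hlog : ∀ x : ℝ, Real.log ‖1 + c ^ 2 * (x : ℂ) ^ 2‖
      = (log (1 + I * c * x) + log (1 - I * c * x)).re := by
    intro x
    have : (1 + c ^ 2 * (x : ℂ) ^ 2 : ℂ) = (1 + I * c * x) * (1 - I * c * x) := by
      ring_nf; rw [I_sq]; ring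
    rw [this, norm_mul, Real.log_mul (by simpa using slitPlane_ne_zero (hp x))
      (by simpa using slitPlane_ne_zero (hm x)), add_re, log_re, log_re]
  have hre : ∀ x : ℝ, ((x : ℂ) * G' x).re = x * (G' x).re := fun x => by simp
  have hfg : (fun x : ℝ => Real.log ‖1 + c ^ 2 * (x : ℂ) ^ 2‖ / x ^ 2)
      = fun x => ((G x).re - x * (G' x).re) / x ^ 2 := by
    ext x
    rw [hlog x, ← hre, ← sub_re]
    congr 2
    simp only [G, G']; ring
  rw [hfg]
  refine bode_ftc (fun x => (G x).re) (fun x => (G' x).re) ∅ countable_empty _ (by simp [G]) ?_ ?_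
    (fun x _ _ => hgd x) ?_ ?_
  · simpa [G'] using hgd 0
  · exact continuous_iff_continuousAt.2 fun x => (hgd x).continuousAt
  · have h1 := bode_log_div _ hne
    have hinv : Tendsto (fun x : ℝ => ((x⁻¹ : ℝ) : ℂ)) atTop (𝓝 0) := by
      simpa [Function.comp_def] using (Complex.continuous_ofReal.tendsto 0).comp tendsto_inv_atTop_zero
    have hIc : 0 < (I * c).im := by simpa using hc
    have h2 : Tendsto (fun x : ℝ => (I * c * (log (((x⁻¹ : ℝ) : ℂ) + I * c)
        - log (((x⁻¹ : ℝ) : ℂ) - I * c))).re) atTop (𝓝 (-(Real.pi * c.re))) := by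
      have ha := (hinv.add_const (I * c)).clog (by
        rw [mem_slitPlane_iff]; right; simpa using hc.ne')
      have hb := (hinv.sub_const (I * c)).clog (by
        rw [mem_slitPlane_iff]; right; simpa using hc.ne')
      have h := ((ha.sub hb).const_mul (I * c))
      have h' := (Complex.continuous_re.tendsto _).comp h
      refine h'.congr' (by rfl) |>.trans (le_of_eq ?_)
      congr 1
      have : log (0 + I * c) - log (0 - I * c) = Real.pi * I := by
        rw [zero_add, zero_sub]
        apply Complex.ext
        · simp [log_re]
        · simp only [sub_im, log_im, arg_neg_eq_arg_sub_pi_of_im_pos hIc]; simp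
      rw [this]
      simp; ring
    have h3 := (h1.add h2).neg
    simp only [zero_add, neg_neg] at h3
    refine h3.congr' ?_
    filter_upwards [eventually_gt_atTop 0] with x hx0
    rw [hlog x]
    have hxi : 0 < x⁻¹ := by positivity
    have hxC : (x : ℂ) ≠ 0 := by exact_mod_cast hx0.ne'
    have e1 : ((x⁻¹ : ℝ) : ℂ) + I * c = ((x⁻¹ : ℝ) : ℂ) * (1 + I * c * x) := by
      push_cast; field_simp
    have e2 : ((x⁻¹ : ℝ) : ℂ) - I * c = ((x⁻¹ : ℝ) : ℂ) * (1 - I * c * x) := by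
      push_cast; field_simp
    rw [e1, e2, log_ofReal_mul hxi (slitPlane_ne_zero (hp x)),
      log_ofReal_mul hxi (slitPlane_ne_zero (hm x)), add_sub_add_left_eq_sub]
    have e3 : G x = (log (1 + I * c * x) + log (1 - I * c * x)) + x * G' x := by
      simp only [G, G']; ring
    rw [e3, add_re _ ((x : ℂ) * G' x), hre]
    simp only [G']
    field_simp
  · rw [← hfg]; exact bode_integrable _ hne

lemma bode_core (c : ℂ) (hc0 : c ≠ 0) :
    ∫ x in Ioi (0 : ℝ), Real.log ‖1 + c ^ 2 * (x : ℂ) ^ 2‖ / x ^ 2 = Real.pi * |c.re| := by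
  rcases lt_trichotomy c.re 0 with h | h | h
  · have := bode_pos (-c) (by simpa using h)
    simpa [abs_of_neg h] using this
  · have e : c = I * (c.im : ℂ) := by apply Complex.ext <;> simp [h]
    have hb : c.im ≠ 0 := fun h' => hc0 (Complex.ext h h')
    have := bode_imag c.im hb
    rw [← e] at this
    rw [this, h]; simp
  · rw [abs_of_pos h]; exact bode_pos c h

lemma bode_poly (P : ℝ[X]) (h0 : P.eval 0 ≠ 0) (x : ℝ) (hx : aeval (I * x) P ≠ 0) :
    2 * Real.log ‖aeval (I * x) P‖ = 2 * Real.log |P.eval 0| +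
      ((P.map (algebraMap ℝ ℂ)).roots.map
        (fun q => Real.log ‖1 + (1 / q) ^ 2 * (x : ℂ) ^ 2‖)).sum := by
  set Q := P.map (algebraMap ℝ ℂ) with hQ
  have hP : ∀ z : ℂ, aeval z P = Q.eval z := fun z => by rw [hQ, eval_map_algebraMap]
  have hQ0 : Q.eval 0 = (P.eval 0 : ℝ) := by
    rw [← hP]
    simpa using aeval_algebraMap_apply ℂ (0:ℝ) P
  have hsp : Q.Splits := IsAlgClosed.splits Q
  have hroot : ∀ q ∈ Q.roots, q ≠ 0 := by
    rintro q hq rfl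
    have := (mem_roots'.1 hq).2
    rw [IsRoot.def, hQ0] at this
    exact h0 (by exact_mod_cast this)
  have hconj : ‖Q.eval (-(I * x))‖ = ‖Q.eval (I * x)‖ := by
    have : (-(I * x) : ℂ) = (starRingEnd ℂ) (I * x) := by simp
    rw [this, ← hP, aeval_conj, RCLike.norm_conj, hP]
  have hmain : Q.eval (I * x) * Q.eval (-(I * x)) = (Q.eval 0) ^ 2 *
      (Q.roots.map (fun q => 1 + (1 / q) ^ 2 * (x : ℂ) ^ 2)).prod := by
    rw [hsp.eval_eq_prod_roots, hsp.eval_eq_prod_roots (-(I * x)), hsp.eval_eq_prod_roots 0,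
      mul_mul_mul_comm, ← Multiset.prod_map_mul, mul_pow, sq (Multiset.prod _),
      ← Multiset.prod_map_mul, mul_assoc (Q.leadingCoeff ^ 2), ← Multiset.prod_map_mul, sq]
    congr 2
    refine Multiset.map_congr rfl fun q hq => ?_
    have := hroot q hq
    field_simp
    ring_nf
    rw [I_sq]; ring
  rw [hP] at hx ⊢
  have hn : ‖Q.eval (I * x)‖ ≠ 0 := by simpa using hx
  have hn' : ‖Q.eval (-(I * x))‖ ≠ 0 := by rwa [hconj]
  have hprod : (Q.roots.map (fun q => 1 + (1 / q) ^ 2 * (x : ℂ) ^ 2)).prod ≠ 0 := by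
    intro h
    rw [h, mul_zero] at hmain
    have := congrArg norm hmain
    rw [norm_mul, norm_zero] at this
    exact (mul_ne_zero hn hn') this
  have h2 : 2 * Real.log ‖Q.eval (I * x)‖ = Real.log ‖Q.eval (I * x) * Q.eval (-(I * x))‖ := by
    rw [norm_mul, Real.log_mul hn hn', hconj]; ring
  rw [h2, hmain, norm_mul, Real.log_mul (by simpa [hQ0] using h0) (by simpa using hprod), norm_pow,
    Real.log_pow, hQ0, Complex.norm_real, Real.norm_eq_abs]
  congr 1
  have h3 : ‖(Q.roots.map (fun q => 1 + (1 / q) ^ 2 * (x : ℂ) ^ 2)).prod‖ =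
      (Q.roots.map (fun q => ‖1 + (1 / q) ^ 2 * (x : ℂ) ^ 2‖)).prod := by
    rw [← coe_nnnorm]
    have := map_multiset_prod (normHom : ℂ →*₀ ℝ) (Q.roots.map (fun q => 1 + (1 / q) ^ 2 * (x : ℂ) ^ 2))
    simpa [Multiset.map_map, Function.comp_def, normHom] using this
  rw [h3, Real.log_multiset_prod, Multiset.map_map]
  · rfl
  · intro y hy
    obtain ⟨q, hq, rfl⟩ := Multiset.mem_map.1 hy
    intro h
    rw [norm_eq_zero] at h
    exact hprod (Multiset.prod_eq_zero (Multiset.mem_map.2 ⟨q, hq, h⟩))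

lemma bode_sum (M : Multiset ℂ) (hM : ∀ q ∈ M, q ≠ 0) :
    IntegrableOn (fun x : ℝ =>
      (M.map (fun q => Real.log ‖1 + (1 / q) ^ 2 * (x : ℂ) ^ 2‖)).sum / x ^ 2) (Ioi 0) ∧
    ∫ x in Ioi (0 : ℝ), (M.map (fun q => Real.log ‖1 + (1 / q) ^ 2 * (x : ℂ) ^ 2‖)).sum / x ^ 2
      = Real.pi * (M.map (fun q => |(1 / q).re|)).sum := by
  induction M using Multiset.induction_on with
  | empty => simp
  | cons a s ih =>
    obtain ⟨h1, h2⟩ := ih fun q hq => hM q (Multiset.mem_cons_of_mem hq)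
    have ha : 1 / a ≠ 0 := one_div_ne_zero (hM a (Multiset.mem_cons_self a s))
    have h3 := bode_integrable ((1 / a) ^ 2) (pow_ne_zero 2 ha)
    simp only [Multiset.map_cons, Multiset.sum_cons, add_div, mul_add]
    refine ⟨h3.add h1, ?_⟩
    rw [integral_add h3 h1, h2, bode_core _ ha]

lemma bode_deriv (P : ℝ[X]) (h0 : P.eval 0 ≠ 0) :
    ((P.map (algebraMap ℝ ℂ)).roots.map (fun q => (1 / q).re)).sum
      = -(P.derivative.eval 0 / P.eval 0) := by
  set Q := P.map (algebraMap ℝ ℂ) with hQ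
  have hev : ∀ P : ℝ[X], (P.map (algebraMap ℝ ℂ)).eval 0 = ((P.eval 0 : ℝ) : ℂ) := fun P => by
    rw [eval_map_algebraMap]
    simpa using aeval_algebraMap_apply ℂ (0:ℝ) P
  have hQ0 : Q.eval 0 = (P.eval 0 : ℝ) := hev P
  have hQ1 : Q.derivative.eval 0 = (P.derivative.eval 0 : ℝ) := by
    rw [hQ, derivative_map]; exact hev _
  have h := (IsAlgClosed.splits Q).eval_derivative_div_eval_of_ne_zero (x := 0)
    (by rw [hQ0]; exact_mod_cast h0)
  rw [hQ0, hQ1] at h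
  have h' := congrArg (fun z => -(Complex.reAddGroupHom z)) h
  simp only [map_multiset_sum, Multiset.map_map, Function.comp_def] at h'
  rw [← Multiset.sum_map_neg] at h'
  have e : Complex.reAddGroupHom ((P.derivative.eval 0 : ℝ) / (P.eval 0 : ℝ) : ℂ)
    = P.derivative.eval 0 / P.eval 0 := by
    rw [← Complex.ofReal_div]; rfl
  rw [e] at h'
  rw [h']
  congr 1
  refine Multiset.map_congr rfl fun q _ => ?_
  change _ = -(1 / (0 - q)).re
  rw [zero_sub, one_div_neg_eq_neg_one_div, neg_re, neg_neg]

lemma bode_sign (q : ℂ) : (1 / q).re = q.re / normSq q := by simp [Complex.inv_re]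

lemma bode_filter (M : Multiset ℂ) :
    (M.map (fun q => |(1 / q).re|)).sum + (M.map (fun q => (1 / q).re)).sum
      = 2 * ((M.filter (fun q => 0 < q.re)).map (fun q => (1 / q).re)).sum := by
  induction M using Multiset.induction_on with
  | empty => simp
  | cons a s ih =>
    simp only [Multiset.map_cons, Multiset.sum_cons]
    by_cases h : 0 < a.re
    · rw [Multiset.filter_cons_of_pos (p := fun q : ℂ => 0 < q.re) _ h, Multiset.map_cons, Multiset.sum_cons]
      have : 0 ≤ (1 / a).re := by rw [bode_sign]; exact div_nonneg h.le (normSq_nonneg _)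
      rw [abs_of_nonneg this]; linarith
    · rw [Multiset.filter_cons_of_neg (p := fun q : ℂ => 0 < q.re) _ h]
      have : (1 / a).re ≤ 0 := by
        rw [bode_sign]; exact div_nonpos_of_nonpos_of_nonneg (not_lt.1 h) (normSq_nonneg _)
      rw [abs_of_nonpos this]; linarith

lemma bode_ae (P : ℝ[X]) (h0 : P ≠ 0) : ∀ᵐ x : ℝ, aeval (I * x) P ≠ 0 := by
  have hfin : {x : ℝ | aeval (I * (x : ℂ)) P = 0}.Finite := by
    have h1 : ((P.map (algebraMap ℝ ℂ)).rootSet ℂ).Finite := rootSet_finite _ _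
    refine Set.Finite.subset (h1.preimage (f := fun x : ℝ => I * (x : ℂ)) ?_) ?_
    · intro x _ y _ h
      simpa using h
    · intro x hx
      rw [mem_preimage, mem_rootSet]
      refine ⟨by simpa using h0, ?_⟩
      simpa using hx
  filter_upwards [hfin.countable.ae_notMem volume] with x hx using hx

end



/-- **Bode complementary sensitivity integral** (Lemma 1).
For a loop transfer function `R = n/d` with (at least) a double pole at `s = 0`
(`X^2 ∣ d`), `n, d` nonzero coprime real polynomials with `deg n ≤ deg d`, and a
stable closed loop (all roots of `d + n` in the open left half plane), the
complementary sensitivity `T = n/(d+n)` satisfies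
`∫₀^∞ ln |T(iω)| / ω² dω = π ∑ₖ Re (1/qₖ) ≥ 0`, the sum running over the roots
`qₖ` of `n` with strictly positive real part, counted with multiplicity. -/
theorem bode_complementary_sensitivity_integral
    (n d : Polynomial ℝ) (hn : n ≠ 0) (hd : d ≠ 0) (hcop : IsCoprime n d)
    (hpole : X ^ 2 ∣ d) (hdeg : n.natDegree ≤ d.natDegree)
    (hstab : ∀ z : ℂ, aeval z (d + n) = 0 → z.re < 0) :
    IntegrableOn
      (fun ω : ℝ => Real.log (‖
        (aeval (Complex.I * ω) n / aeval (Complex.I * ω) (d + n) : ℂ)‖) / ω ^ 2)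
      (Ioi (0 : ℝ)) ∧
    (∫ ω in Ioi (0 : ℝ), Real.log (‖
        (aeval (Complex.I * ω) n / aeval (Complex.I * ω) (d + n) : ℂ)‖) / ω ^ 2)
      = Real.pi *
        ((((n.map (algebraMap ℝ ℂ)).roots.filter (fun q => 0 < q.re)).map
            (fun q => (1 / q).re)).sum) ∧
    0 ≤ ∫ ω in Ioi (0 : ℝ), Real.log (‖
        (aeval (Complex.I * ω) n / aeval (Complex.I * ω) (d + n) : ℂ)‖) / ω ^ 2 := by
  obtain ⟨e, he⟩ := hpole
  set p := d + n with hp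
  have hd0 : d.eval 0 = 0 := by simp [he]
  have hd1 : d.derivative.eval 0 = 0 := by simp [he]
  have hn0 : n.eval 0 ≠ 0 := by
    intro h
    obtain ⟨u, v, huv⟩ := hcop
    have := congrArg (eval 0) huv
    simp [h, hd0] at this
  have hp0 : p.eval 0 = n.eval 0 := by simp [hp, hd0]
  have hp1 : p.derivative.eval 0 = n.derivative.eval 0 := by simp [hp, hd1]
  have hp0' : p.eval 0 ≠ 0 := by rwa [hp0]
  have hpne : p ≠ 0 := by rintro h; simp [h] at hp0'
  have hev : ∀ P : ℝ[X], P.eval 0 ≠ 0 → ∀ q ∈ (P.map (algebraMap ℝ ℂ)).roots, q ≠ 0 := by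
    rintro P hP q hq rfl
    have := (mem_roots'.1 hq).2
    rw [IsRoot.def, eval_map_algebraMap] at this
    have h2 := aeval_algebraMap_apply ℂ (0:ℝ) P
    rw [map_zero, this] at h2
    have h3 : (0 : ℂ) = ((P.eval 0 : ℝ) : ℂ) := by simpa using h2
    exact hP (by exact_mod_cast h3.symm)
  obtain ⟨in1, in2⟩ := bode_sum _ (hev n hn0)
  obtain ⟨ip1, ip2⟩ := bode_sum _ (hev p hp0')
  have hae : (fun ω : ℝ => (1 / 2 : ℝ) * ((((n.map (algebraMap ℝ ℂ)).roots.map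
        (fun q => Real.log ‖1 + (1 / q) ^ 2 * (ω : ℂ) ^ 2‖)).sum / ω ^ 2) -
        (((p.map (algebraMap ℝ ℂ)).roots.map
        (fun q => Real.log ‖1 + (1 / q) ^ 2 * (ω : ℂ) ^ 2‖)).sum / ω ^ 2)))
      =ᵐ[volume.restrict (Ioi 0)] (fun ω : ℝ => Real.log (‖
        (aeval (Complex.I * ω) n / aeval (Complex.I * ω) p : ℂ)‖) / ω ^ 2) := by
    apply ae_restrict_of_ae
    filter_upwards [bode_ae n hn, bode_ae p hpne] with x hxn hxp
    have h1 := bode_poly n hn0 x hxn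
    have h2 := bode_poly p hp0' x hxp
    rw [norm_div, Real.log_div (by simpa using hxn) (by simpa using hxp)]
    rw [hp0] at h2
    rw [← sub_div, ← mul_div_assoc]
    congr 1
    linarith
  have hval : (∫ ω in Ioi (0 : ℝ), Real.log (‖
        (aeval (Complex.I * ω) n / aeval (Complex.I * ω) p : ℂ)‖) / ω ^ 2)
      = Real.pi *
        ((((n.map (algebraMap ℝ ℂ)).roots.filter (fun q => 0 < q.re)).map
            (fun q => (1 / q).re)).sum) := by
    rw [← integral_congr_ae hae, integral_const_mul, integral_sub in1 ip1, in2, ip2]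
    have f1 := bode_filter (n.map (algebraMap ℝ ℂ)).roots
    have f2 := bode_filter (p.map (algebraMap ℝ ℂ)).roots
    have f3 : (p.map (algebraMap ℝ ℂ)).roots.filter (fun q => 0 < q.re) = 0 := by
      rw [Multiset.filter_eq_nil]
      intro q hq
      have := (mem_roots'.1 hq).2
      rw [IsRoot.def, eval_map_algebraMap] at this
      exact not_lt.2 (hstab q this).le
    rw [f3] at f2
    have d1 := bode_deriv n hn0
    have d2 := bode_deriv p hp0'
    rw [hp0, hp1, ← d1] at d2
    rw [d2] at f2
    simp only [Multiset.map_zero, Multiset.sum_zero, mul_zero] at f2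
    rw [← mul_sub, eq_sub_of_add_eq f1, eq_sub_of_add_eq f2]
    ring
  refine ⟨((in1.sub ip1).const_mul (1 / 2)).congr hae, hval, ?_⟩
  rw [hval]
  refine mul_nonneg Real.pi_pos.le (Multiset.sum_nonneg ?_)
  intro y hy
  obtain ⟨q, hq, rfl⟩ := Multiset.mem_map.1 hy
  rw [bode_sign]
  exact div_nonneg (Multiset.mem_filter.1 hq).2.le (normSq_nonneg _)
end

section
/- Let n and d be nonzero coprime polynomials with real coefficients such that s^2 divides d and deg n ≤ deg d, and assume every root of d + n has strictly negative real part. Set T(s) = n(s)/(d(s)+n(s)). If there exists ω₀ ∈ ℝ with |T(iω₀)| < 1, then there exists ω₁ ∈ ℝ with |T(iω₁)| > 1. -/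
open Polynomial Complex

open Filter Topology Bornology Asymptotics in
lemma wb_lead (P : Polynomial ℝ) :
    Tendsto (fun z : ℂ => aeval z P / z ^ P.natDegree) (cobounded ℂ)
      (𝓝 (P.leadingCoeff : ℂ)) := by
  have h1 : Tendsto (fun z : ℂ => aeval z⁻¹ P.reverse) (cobounded ℂ)
      (𝓝 (P.leadingCoeff : ℂ)) := by
    have hc : Continuous (fun z : ℂ => aeval z P.reverse) := P.reverse.continuous_aeval
    have := (hc.tendsto 0).comp (tendsto_inv₀_cobounded (α := ℂ))
    rw [← coeff_zero_eq_aeval_zero', coeff_zero_reverse] at this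
    exact this
  refine h1.congr' ?_
  filter_upwards [eventually_ne_cobounded (0:ℂ)] with z hz
  rw [eq_div_iff (pow_ne_zero _ hz)]
  letI : Invertible z := invertibleOfNonzero hz
  have := eval₂_reverse_mul_pow (algebraMap ℝ ℂ) z P
  rw [invOf_eq_inv] at this
  exact this

open Filter Topology Bornology Asymptotics in
lemma wb_bounded (n q : Polynomial ℝ) (hq : q ≠ 0) (h : n.natDegree ≤ q.natDegree) :
    (fun z : ℂ => aeval z n / aeval z q) =O[cobounded ℂ] (fun _ => (1:ℝ)) := by
  have hlc : (q.leadingCoeff : ℂ) ≠ 0 := by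
    simpa using hq
  have h1 := ((wb_lead n).div (wb_lead q) hlc).isBigO_one ℝ
  refine IsBigO.trans ?_ h1
  refine IsBigO.of_bound 1 ?_
  filter_upwards [tendsto_norm_cobounded_atTop.eventually_ge_atTop (1:ℝ)] with z hz
  have hz0 : z ≠ 0 := by
    rintro rfl
    simp at hz
    linarith
  rw [one_mul, Pi.div_apply]
  obtain ⟨k, hk⟩ := Nat.exists_eq_add_of_le h
  have : aeval z n / z ^ n.natDegree / (aeval z q / z ^ q.natDegree)
      = aeval z n / aeval z q * z ^ k := by
    rw [hk, pow_add]
    by_cases h0 : aeval z q = 0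
    · simp [h0]
    · field_simp
  rw [this, norm_mul, norm_pow]
  exact le_mul_of_one_le_right (norm_nonneg _) (one_le_pow₀ hz)

open Filter Topology Bornology Asymptotics in
lemma wb_proper (n q : Polynomial ℝ) (hn : n ≠ 0)
    (h : ∀ ω : ℝ, ‖aeval (Complex.I * ω) n‖ ≤ ‖aeval (Complex.I * ω) q‖) :
    n.natDegree ≤ q.natDegree := by
  by_contra! hlt
  have ht : Tendsto (fun ω : ℝ => Complex.I * (ω : ℂ)) atTop (cobounded ℂ) := by
    rw [← tendsto_norm_atTop_iff_cobounded]
    simpa using tendsto_abs_atTop_atTop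
  obtain ⟨k, hk⟩ := Nat.exists_eq_add_of_lt hlt
  have hz : Tendsto (fun z : ℂ => z⁻¹ ^ (k+1)) (cobounded ℂ) (𝓝 0) := by
    simpa using (tendsto_inv₀_cobounded (α := ℂ)).pow (k+1)
  have h2 := (((wb_lead q).mul hz).comp ht).norm
  have h1 := ((wb_lead n).comp ht).norm
  have := le_of_tendsto_of_tendsto' h1 h2 (fun ω => by
    simp only [Function.comp]
    have e : aeval (Complex.I * (ω:ℂ)) q / (Complex.I * (ω:ℂ)) ^ q.natDegree
        * (Complex.I * (ω:ℂ))⁻¹ ^ (k+1)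
        = aeval (Complex.I * (ω:ℂ)) q / (Complex.I * (ω:ℂ)) ^ n.natDegree := by
      rw [hk, add_assoc, pow_add _ q.natDegree, inv_pow, ← div_eq_mul_inv, div_div]
    rw [e, norm_div, norm_div]
    gcongr
    exact h ω)
  simp at this
  exact hn this

open Filter Topology Bornology Asymptotics in
lemma wb_max (n q : Polynomial ℝ) (hn : n ≠ 0)
    (hstab : ∀ z : ℂ, aeval z q = 0 → z.re < 0)
    (h : ∀ ω : ℝ, ‖(aeval (Complex.I * ω) n / aeval (Complex.I * ω) q : ℂ)‖ ≤ 1)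
    (z : ℂ) (hz : 0 ≤ z.re) : ‖(aeval z n / aeval z q : ℂ)‖ ≤ 1 := by
  have hq0 : ∀ z : ℂ, 0 ≤ z.re → aeval z q ≠ 0 := fun z hz h0 => by
    linarith [hstab z h0]
  have hq : q ≠ 0 := by
    rintro rfl
    exact hq0 0 (by simp) (by simp)
  have hdeg := wb_proper n q hn (fun ω => by
    have := h ω
    rwa [norm_div, div_le_one (norm_pos_iff.2 (hq0 _ (by simp)))] at this)
  have hb := wb_bounded n q hq hdeg
  refine PhragmenLindelof.right_half_plane_of_bounded_on_real
    (f := fun z => aeval z n / aeval z q) ?_ ?_ ?_ ?_ hz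
  · apply DifferentiableOn.diffContOnCl
    intro w hw
    have hw' : 0 ≤ w.re := by
      rw [Complex.closure_setOf_lt_re] at hw
      exact hw
    exact (((n.differentiable_aeval (𝕜 := ℂ)) w).div
      ((q.differentiable_aeval (𝕜 := ℂ)) w) (hq0 w hw')).differentiableWithinAt
  · refine ⟨0, by norm_num, 0, ?_⟩
    simpa using hb.mono inf_le_left
  · have ht : Tendsto (fun x : ℝ => (x : ℂ)) atTop (cobounded ℂ) := by
      rw [← tendsto_norm_atTop_iff_cobounded]
      simpa using tendsto_abs_atTop_atTop
    have := hb.comp_tendsto ht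
    exact (isBigO_one_iff ℝ).1 this
  · intro x
    simpa [mul_comm] using h x

open Filter Topology in
theorem wb_aux
    (n d : Polynomial ℝ) (hn : n ≠ 0) (hd : d ≠ 0)
    (hpole : X ^ 2 ∣ d)
    (hstab : ∀ z : ℂ, aeval z (d + n) = 0 → z.re < 0)
    (h : ∀ ω : ℝ, ‖(aeval (Complex.I * ω) n / aeval (Complex.I * ω) (d + n) : ℂ)‖ ≤ 1) :
    False := by
  have hm := wb_max n (d+n) hn hstab h
  have hq0 : ∀ z : ℂ, 0 ≤ z.re → aeval z (d+n) ≠ 0 := fun z hz h0 => by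
    linarith [hstab z h0]
  obtain ⟨e, he, hnd⟩ := exists_eq_pow_rootMultiplicity_mul_and_not_dvd d hd 0
  have hk : 2 ≤ d.rootMultiplicity 0 := by
    rw [le_rootMultiplicity_iff hd]
    simpa using hpole
  generalize d.rootMultiplicity 0 = k at he hk
  simp only [map_zero, sub_zero] at he hnd
  rw [X_dvd_iff] at hnd
  -- value at zero
  have hqv : (d+n).coeff 0 ≠ 0 := by
    intro h0
    refine hq0 0 (by simp) ?_
    rw [← coeff_zero_eq_aeval_zero', h0]
    simp
  set c : ℝ := e.coeff 0 / (d+n).coeff 0 with hc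
  have hc0 : c ≠ 0 := div_ne_zero hnd hqv
  have hg : Tendsto (fun z : ℂ => (aeval z e / aeval z (d+n) : ℂ)) (𝓝 0) (𝓝 (c:ℂ)) := by
    have h1 := ((e.continuous_aeval (A := ℂ)).tendsto 0).div
      (((d+n).continuous_aeval (A := ℂ)).tendsto 0) (hq0 0 (by simp))
    rw [← coeff_zero_eq_aeval_zero', ← coeff_zero_eq_aeval_zero'] at h1
    rw [hc, ofReal_div]
    exact h1
  -- key inequality
  have key : ∀ z : ℂ, 0 ≤ z.re → 0 ≤ (z ^ k * (aeval z e / aeval z (d+n))).re := by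
    intro z hz
    have h1 := hm z hz
    have h2 : (z ^ k * (aeval z e / aeval z (d+n)) : ℂ) = 1 - aeval z n / aeval z (d+n) := by
      have := hq0 z hz
      have h3 : aeval z d = z ^ k * aeval z e := by
        conv_lhs => rw [he]
        simp
      rw [eq_sub_iff_add_eq, ← mul_div_assoc, ← add_div, ← h3, ← map_add, div_self this]
    rw [h2, sub_re, one_re]
    linarith [Complex.re_le_norm (aeval z n / aeval z (d+n) : ℂ)]
  -- along a ray
  have ray : ∀ (u : ℂ) (σ : ℝ), 0 ≤ u.re → u ^ k = (σ : ℂ) → 0 ≤ σ * c := by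
    intro u σ hu hσ
    have ht : Tendsto (fun r : ℝ => (r : ℂ) * u) (𝓝[>] 0) (𝓝 0) := by
      have : Continuous (fun r : ℝ => (r : ℂ) * u) := by fun_prop
      have := this.tendsto 0
      simp only [ofReal_zero, zero_mul] at this
      exact this.mono_left nhdsWithin_le_nhds
    have h1 := (((Complex.continuous_re.tendsto _).comp (hg.comp ht)).const_mul σ)
    refine ge_of_tendsto h1 ?_
    filter_upwards [self_mem_nhdsWithin] with r hr
    have hr : 0 < r := hr
    have h2 := key (r * u) (by simpa using mul_nonneg hr.le hu)
    rw [mul_pow, hσ, ← ofReal_pow, ← ofReal_mul, re_ofReal_mul, mul_assoc] at h2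
    exact nonneg_of_mul_nonneg_right h2 (pow_pos hr k)
  have r1 := ray 1 1 (by simp) (by simp)
  have r2 := ray (Complex.exp ((Real.pi / k : ℝ) * Complex.I)) (-1) (by
      rw [Complex.exp_ofReal_mul_I_re]
      have hk' : (2:ℝ) ≤ k := by exact_mod_cast hk
      apply Real.cos_nonneg_of_neg_pi_div_two_le_of_le
      · have : 0 ≤ Real.pi / k := by positivity
        linarith [Real.pi_pos]
      · gcongr) (by
      have hk' : (k:ℂ) ≠ 0 := by
        have : k ≠ 0 := by omega
        exact_mod_cast this
      rw [← Complex.exp_nat_mul]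
      have : (k:ℂ) * (((Real.pi / k : ℝ) : ℂ) * Complex.I) = Real.pi * Complex.I := by
        push_cast
        field_simp
      rw [this, Complex.exp_pi_mul_I]
      simp)
  exact hc0 (by linarith)

/-- **Waterbed effect** (consequence of the Bode complementary sensitivity
integral, Lemma 1). For a loop transfer function `R = n/d` with at least a
double pole at `s = 0` and a stable closed loop (all roots of `d + n` in the
open left half plane), if the complementary sensitivity `T = n/(d+n)` has
modulus `< 1` at some frequency on the imaginary axis, then it has modulus
`> 1` at some other frequency. -/
theorem waterbed_complementary_sensitivity
    (n d : Polynomial ℝ) (hn : n ≠ 0) (hd : d ≠ 0) (hcop : IsCoprime n d)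
    (hpole : X ^ 2 ∣ d) (hdeg : n.natDegree ≤ d.natDegree)
    (hstab : ∀ z : ℂ, aeval z (d + n) = 0 → z.re < 0)
    (hlt : ∃ ω₀ : ℝ, ‖
      (aeval (Complex.I * ω₀) n / aeval (Complex.I * ω₀) (d + n) : ℂ)‖ < 1) :
    ∃ ω₁ : ℝ, 1 < ‖
      (aeval (Complex.I * ω₁) n / aeval (Complex.I * ω₁) (d + n) : ℂ)‖ := by
  by_contra! h
  exact wb_aux n d hn hd hpole hstab h
end

section
/- Let n_K and d_K be coprime polynomials with real coefficients with deg n_K ≤ deg d_K + 1, n_K(0) ≠ 0 and d_K(0) ≠ 0, and assume every root of the closed-loop polynomial s²·d_K(s) + n_K(s) has strictly negative real part. Then there exists ω ∈ ℝ such that |n_K(iω) / ((iω)²·d_K(iω) + n_K(iω))| > 1. -/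
open Polynomial Complex

/-- **Standard string instability** for a unidirectional chain of double
integrators with relative-position feedback `u_i = K(s)(x_{i-1} - x_i)`,
`K = n_K/d_K` a linear controller with nonzero finite DC gain.  If the closed
loop is stable (all roots of `s² d_K + n_K` in the open left half plane), then
the error-propagation transfer function
`T(iω) = n_K(iω) / ((iω)² d_K(iω) + n_K(iω))` has modulus `> 1` at some
frequency, so `L₂` string stability fails. -/
theorem string_instability_relative_feedback
    (nK dK : Polynomial ℝ) (hcop : IsCoprime nK dK)
    (hdeg : nK.natDegree ≤ dK.natDegree + 1)
    (hn0 : nK.eval 0 ≠ 0) (hd0 : dK.eval 0 ≠ 0)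
    (hstab : ∀ z : ℂ, aeval z (X ^ 2 * dK + nK) = 0 → z.re < 0) :
    ∃ ω : ℝ, 1 < norm
      (aeval (Complex.I * ω) nK /
        ((Complex.I * ω) ^ 2 * aeval (Complex.I * ω) dK
          + aeval (Complex.I * ω) nK) : ℂ) := by
  by_contra! hcon
  set P : Polynomial ℝ := X ^ 2 * dK + nK with hP
  have hPe : ∀ z : ℂ, aeval z P = z ^ 2 * aeval z dK + aeval z nK := by
    intro z; simp [hP]
  have hP0 : ∀ z : ℂ, 0 ≤ z.re → aeval z P ≠ 0 := fun z hz h => absurd (hstab z h) (not_lt.2 hz)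
  have hdne : dK ≠ 0 := by rintro rfl; simp at hd0
  have hdegP : nK.degree ≤ P.degree := by
    have h1 : (X ^ 2 * dK).natDegree = dK.natDegree + 2 := by
      rw [natDegree_mul (by simp) hdne, natDegree_X_pow]; ring
    have h2 : nK.natDegree < (X ^ 2 * dK).natDegree := by omega
    have h3 : nK.degree < (X ^ 2 * dK).degree := degree_lt_degree h2
    rw [hP, degree_add_eq_left_of_degree_lt h3]
    exact h3.le
  set f : ℂ → ℂ := fun z => aeval z nK / aeval z P with hf
  -- boundedness near infinity
  obtain ⟨c, hc0, hc⟩ : ∃ c : ℝ, 0 ≤ c ∧ ∀ᶠ z in Bornology.cobounded ℂ, ‖f z‖ ≤ c := by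
    have h := isBigO_cobounded_of_degree_le (P := nK.map (algebraMap ℝ ℂ))
      (Q := P.map (algebraMap ℝ ℂ)) (by simpa [degree_map] using hdegP)
    obtain ⟨c, hc0, hc⟩ := h.exists_nonneg
    refine ⟨c, hc0, ?_⟩
    filter_upwards [hc.bound] with z hz
    simp only [eval_map_algebraMap] at hz
    simp only [hf, norm_div]
    exact div_le_of_le_mul₀ (norm_nonneg _) hc0 hz
  have hda : ∀ (p : Polynomial ℝ) (z : ℂ), DifferentiableAt ℂ (fun z => aeval z p) z :=
    fun p z => p.differentiableAt_aeval
  have hcl : closure {z : ℂ | 0 < z.re} = {z : ℂ | 0 ≤ z.re} := closure_setOfPred_lt_re 0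
  have hdiff : DiffContOnCl ℂ f {z | 0 < z.re} := by
    have hd : DifferentiableOn ℂ f (closure {z : ℂ | 0 < z.re}) := by
      rw [hcl]
      intro z hz
      exact ((hda nK z).div (hda P z)
        (hP0 z hz)).differentiableWithinAt
    exact hd.diffContOnCl
  have hbound : ∀ z : ℂ, 0 ≤ z.re → ‖f z‖ ≤ 1 := by
    intro z hz
    refine PhragmenLindelof.right_half_plane_of_bounded_on_real hdiff ⟨1, by norm_num, 0, ?_⟩
      ?_ ?_ hz
    · refine Asymptotics.IsBigO.of_bound c ?_
      filter_upwards [hc.filter_mono inf_le_left] with z hz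
      simpa using hz
    · refine ⟨c, ?_⟩
      rw [Filter.eventually_map]
      have ht : Filter.Tendsto (fun x : ℝ => (x : ℂ)) Filter.atTop (Bornology.cobounded ℂ) := by
        rw [← tendsto_norm_atTop_iff_cobounded]
        simpa using Filter.tendsto_abs_atTop_atTop
      exact ht.eventually hc
    · intro x
      have := hcon x
      simp only [hf, hPe, mul_comm (x : ℂ) I]
      exact this
  -- behaviour near zero
  set g : ℂ → ℂ := fun z => aeval z dK / aeval z P with hg
  have hfg : ∀ z : ℂ, 0 ≤ z.re → f z = 1 - z ^ 2 * g z := by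
    intro z hz
    have h := hP0 z hz
    simp only [hf, hg]
    field_simp
    rw [hPe]; ring
  have hg0 : g 0 = ((dK.eval 0 / nK.eval 0 : ℝ) : ℂ) := by
    have e : ∀ p : Polynomial ℝ, aeval (0 : ℂ) p = ((p.eval 0 : ℝ) : ℂ) := by
      intro p
      have := aeval_algebraMap_apply_eq_algebraMap_eval (A := ℂ) (0 : ℝ) p
      simpa using this
    simp only [hg, e]
    simp [hP]
  set q : ℝ := dK.eval 0 / nK.eval 0 with hq
  have hq0 : q ≠ 0 := div_ne_zero hd0 hn0
  obtain ⟨w, hw, hwq⟩ : ∃ w : ℂ, 0 ≤ w.re ∧ (w ^ 2 * (q : ℂ)).re < 0 := by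
    rcases lt_or_gt_of_ne hq0 with h | h
    · exact ⟨1, by simp, by simpa using h⟩
    · exact ⟨I, by simp, by simpa using h⟩
  have hgc : ContinuousAt g 0 :=
    (hda dK 0).continuousAt.div (hda P 0).continuousAt
      (hP0 0 (by simp))
  have hcont : ContinuousAt (fun r : ℝ => (w ^ 2 * g (r * w)).re) 0 := by
    have h1 : ContinuousAt (fun r : ℝ => g (r * w)) 0 := by
      refine ContinuousAt.comp (f := fun r : ℝ => (r : ℂ) * w) (g := g) ?_ (by fun_prop)
      simpa using hgc
    exact Complex.continuous_re.continuousAt.comp (continuousAt_const.mul h1)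
  have hev : ∀ᶠ r : ℝ in nhds 0, (w ^ 2 * g (r * w)).re < 0 :=
    hcont.eventually_lt continuousAt_const (by simpa [hg0] using hwq)
  obtain ⟨r, hr, hr0⟩ := ((hev.filter_mono nhdsWithin_le_nhds).and
    (self_mem_nhdsWithin : Set.Ioi (0 : ℝ) ∈ nhdsWithin 0 (Set.Ioi 0))).exists
  have hr0 : 0 < r := hr0
  have hz : 0 ≤ ((r : ℂ) * w).re := by
    rw [re_ofReal_mul]; positivity
  have hb := (Complex.re_le_norm _).trans (hbound _ hz)
  have he : ((r : ℂ) * w) ^ 2 * g (r * w) = ((r ^ 2 : ℝ) : ℂ) * (w ^ 2 * g (r * w)) := by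
    push_cast; ring
  rw [hfg _ hz, he, sub_re, re_ofReal_mul, one_re] at hb
  have : r ^ 2 * (w ^ 2 * g (r * w)).re < 0 := mul_neg_of_pos_of_neg (by positivity) hr
  linarith
end

section
/- For every h ∈ ℝ, every nonzero ω ∈ ℝ, and every nonzero z ∈ ℂ such that −ω² + (1 + i h ω)z ≠ 0, one has | z / (−ω² + (1 + i h ω)z) | < 1 if and only if (h − ω · Im(1/z))² > Re(1/z) · (2 − ω² · Re(1/z)). -/
open Complex

/-- Pointwise frequency-domain criterion behind Proposition 1(b): with
`z = K(iω)` the value of the controller at `s = iω`, the error-propagation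
gain `T(iω) = z / (-ω² + (1 + ihω)z)` has modulus `< 1` if and only if
`(h - ω Im(1/z))² > Re(1/z) (2 - ω² Re(1/z))`. -/
theorem headway_criterion_b
    (h : ℝ) (ω : ℝ) (hω : ω ≠ 0) (z : ℂ) (hz : z ≠ 0)
    (hden : -(ω : ℂ) ^ 2 + (1 + Complex.I * h * ω) * z ≠ 0) :
    ‖z / (-(ω : ℂ) ^ 2 + (1 + Complex.I * h * ω) * z)‖ < 1
      ↔ (h - ω * (1 / z).im) ^ 2 > (1 / z).re * (2 - ω ^ 2 * (1 / z).re) := by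
  obtain ⟨w, hw⟩ : ∃ w : ℂ, w = 1 / z := ⟨_, rfl⟩
  have hzw : z * w = 1 := by rw [hw]; field_simp
  have key : -(ω : ℂ) ^ 2 + (1 + Complex.I * h * ω) * z
      = z * (1 + Complex.I * h * ω - (ω : ℂ) ^ 2 * w) := by
    linear_combination (ω : ℂ) ^ 2 * hzw
  have hω2 : 0 < ω ^ 2 := by positivity
  rw [norm_div, div_lt_one (norm_pos_iff.mpr hden), key, norm_mul,
    lt_mul_iff_one_lt_right (norm_pos_iff.mpr hz), ← hw]
  have e : (1 + Complex.I * h * ω - (ω : ℂ) ^ 2 * w)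
      = ((1 - ω ^ 2 * w.re : ℝ) : ℂ) + ((h * ω - ω ^ 2 * w.im : ℝ) : ℂ) * Complex.I := by
    conv_lhs => rw [← Complex.re_add_im w]
    push_cast
    ring
  rw [e, Complex.norm_add_mul_I, Real.lt_sqrt zero_le_one, gt_iff_lt,
    ← mul_lt_mul_iff_right₀ hω2 (b := w.re * (2 - ω ^ 2 * w.re))]
  constructor <;> intro H <;> nlinarith [H]
end

section
/- Let a, b, h ∈ ℝ with b ≥ 0, a > 2b² (hence a > 0) and h > sqrt(2/a). Then for every nonzero ω ∈ ℝ, writing z = a + i b ω, one has (h − ω · Im(1/z))² > Re(1/z) · (2 − ω² · Re(1/z)); consequently, whenever −ω² + (1 + i h ω)(a + i b ω) ≠ 0, |(a + i b ω)/(−ω² + (1 + i h ω)(a + i b ω))| < 1. -/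
open Complex

/-- Specialization of Proposition 1(b) to a PD controller `K(s) = bs + a`,
so `K(iω) = a + ibω`.  If `b ≥ 0`, `a > 2b²` and the time headway satisfies
`h > √(2/a)`, then the headway criterion holds at every frequency `ω ≠ 0`,
and consequently the error-propagation gain
`T(iω) = K(iω)/(-ω² + (1 + ihω)K(iω))` has modulus `< 1` for all `ω ≠ 0`. -/
theorem pd_controller_headway
    (a b h : ℝ) (hb : 0 ≤ b) (ha : a > 2 * b ^ 2) (hh : h > Real.sqrt (2 / a)) :
    ∀ ω : ℝ, ω ≠ 0 →
      ((h - ω * (1 / ((a : ℂ) + Complex.I * b * ω)).im) ^ 2 >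
        (1 / ((a : ℂ) + Complex.I * b * ω)).re *
          (2 - ω ^ 2 * (1 / ((a : ℂ) + Complex.I * b * ω)).re)) ∧
      (-(ω : ℂ) ^ 2 + (1 + Complex.I * h * ω) * ((a : ℂ) + Complex.I * b * ω) ≠ 0 →
        ‖(((a : ℂ) + Complex.I * b * ω) /
          (-(ω : ℂ) ^ 2 + (1 + Complex.I * h * ω) * ((a : ℂ) + Complex.I * b * ω)))‖
          < 1) := by
  intro ω hω
  have hω2 : 0 < ω ^ 2 := by positivity
  have hh0 : 0 < h := lt_of_le_of_lt (Real.sqrt_nonneg _) hh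
  have hh2 : 2 / a < h ^ 2 := (Real.sqrt_lt' hh0).1 hh
  have ha0 : 0 < a := by nlinarith [sq_nonneg b]
  have hha : 2 < h ^ 2 * a := (div_lt_iff₀ ha0).1 hh2
  have hD : 0 < a ^ 2 + b ^ 2 * ω ^ 2 := by positivity
  have hz : (a : ℂ) + Complex.I * b * ω = ⟨a, b * ω⟩ := by
    apply Complex.ext <;> simp
  have hn : Complex.normSq ⟨a, b * ω⟩ = a ^ 2 + b ^ 2 * ω ^ 2 := by
    rw [Complex.normSq_mk]; ring
  have hre : (1 / ((a : ℂ) + Complex.I * b * ω)).re = a / (a ^ 2 + b ^ 2 * ω ^ 2) := by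
    rw [hz, one_div, Complex.inv_re, hn]
  have him : (1 / ((a : ℂ) + Complex.I * b * ω)).im = -(b * ω) / (a ^ 2 + b ^ 2 * ω ^ 2) := by
    rw [hz, one_div, Complex.inv_im, hn]
  refine ⟨?_, fun hne => ?_⟩
  · rw [hre, him]
    have e : h - ω * (-(b * ω) / (a ^ 2 + b ^ 2 * ω ^ 2))
        = h + b * ω ^ 2 / (a ^ 2 + b ^ 2 * ω ^ 2) := by ring
    rw [e]
    have h1 : 0 ≤ b * ω ^ 2 / (a ^ 2 + b ^ 2 * ω ^ 2) := by positivity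
    have h2 : a / (a ^ 2 + b ^ 2 * ω ^ 2) ≤ 1 / a := by
      rw [div_le_div_iff₀ hD ha0]
      nlinarith [mul_nonneg (sq_nonneg b) hω2.le]
    have h3 : 2 / a = 2 * (1 / a) := by ring
    have h4 : 0 ≤ ω ^ 2 * (a / (a ^ 2 + b ^ 2 * ω ^ 2)) ^ 2 := by positivity
    nlinarith [mul_nonneg hh0.le h1]
  · rw [norm_div, div_lt_one (norm_pos_iff.2 hne)]
    have hd : -(ω : ℂ) ^ 2 + (1 + Complex.I * h * ω) * ((a : ℂ) + Complex.I * b * ω)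
        = ⟨a - ω ^ 2 * (1 + h * b), ω * (b + h * a)⟩ := by
      apply Complex.ext <;> simp [pow_two] <;> ring
    rw [hd, hz]
    refine lt_of_pow_lt_pow_left₀ 2 (norm_nonneg _) ?_
    rw [← Complex.normSq_eq_norm_sq, ← Complex.normSq_eq_norm_sq, hn, Complex.normSq_mk]
    have h5 : 0 < ω ^ 2 * (ω ^ 2 * (1 + h * b) ^ 2 + a * (h ^ 2 * a - 2)) := by
      have : 0 < h ^ 2 * a - 2 := by linarith
      positivity
    nlinarith [h5]
end

section
/- Let h ≥ 0 and let K : ℝ → ℂ be a continuous function with K(0) ≠ 0 such that D(ω) := −ω² + (1 + i h ω)·K(ω) ≠ 0 for every ω ∈ ℝ. Define T(ω) = K(ω)/D(ω) and L(ω) = 1/D(ω). Then for every c > 0 there exist N ∈ ℕ and a nonzero square-integrable function d : ℝ → ℂ such that ∫_ℝ ( Σ_{i=0}^{N−1} |T(ω)|^{2i} ) · |L(ω)|² · |d(ω)|² dω > c · ∫_ℝ |d(ω)|² dω. -/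
open MeasureTheory Complex Finset

/-- **Theorem 1** (frequency domain).  In the vehicle chain `s²xᵢ = uᵢ + dᵢ`
with time-headway error `eᵢ = x_{i-1} - xᵢ - h s xᵢ` and controller
`uᵢ = K(s)eᵢ` with bounded nonzero DC gain `K(0) ≠ 0`, a disturbance on the
leader gives `eᵢ(iω) = T(iω)^{i-1} L(iω) d₀(iω)` with
`T = K/D`, `L = 1/D`, `D(ω) = -ω² + (1 + ihω)K(ω)`.  The ratio of the squared
`(L₂, l₂)` norm of the errors to `‖d₀‖²` is unbounded over `N` and `d₀`, so no
time headway `h ≥ 0` with a stabilizing linear controller of bounded DC gain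
achieves `(L₂, l₂)` string stability. -/
theorem theorem1_no_L2l2_string_stability_bounded_DC_gain
    (h : ℝ) (hh : 0 ≤ h) (K : ℝ → ℂ) (hKcont : Continuous K) (hK0 : K 0 ≠ 0)
    (hD : ∀ ω : ℝ, -(ω : ℂ) ^ 2 + (1 + Complex.I * h * ω) * K ω ≠ 0)
    (T L : ℝ → ℂ)
    (hT : ∀ ω : ℝ, T ω = K ω / (-(ω : ℂ) ^ 2 + (1 + Complex.I * h * ω) * K ω))
    (hL : ∀ ω : ℝ, L ω = 1 / (-(ω : ℂ) ^ 2 + (1 + Complex.I * h * ω) * K ω)) :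
    ∀ c : ℝ, 0 < c → ∃ (N : ℕ) (d : ℝ → ℂ), MemLp d 2 (volume : Measure ℝ) ∧
      (0 < ∫ ω : ℝ, ‖d ω‖ ^ 2) ∧
      (∫ ω : ℝ, (∑ i ∈ Finset.range N, ‖T ω‖ ^ (2 * i)) *
          ‖L ω‖ ^ 2 * ‖d ω‖ ^ 2)
        > c * ∫ ω : ℝ, ‖d ω‖ ^ 2 := by
  intro c hc
  have hL0 : 0 < ‖L 0‖ ^ 2 := by
    have : L 0 ≠ 0 := by
      rw [hL]
      exact one_div_ne_zero (hD 0)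
    positivity
  have hT0 : T 0 = 1 := by
    rw [hT]
    simp [hK0]
  obtain ⟨N, hN⟩ := exists_nat_gt ((c + 1) / ‖L 0‖ ^ 2)
  rw [div_lt_iff₀ hL0] at hN
  have hDc : Continuous fun ω : ℝ => -(ω : ℂ) ^ 2 + (1 + Complex.I * h * ω) * K ω := by
    fun_prop
  have hTc : Continuous T := by
    rw [funext hT]
    exact hKcont.div hDc hD
  have hLc : Continuous L := by
    rw [funext hL]
    exact continuous_const.div hDc hD
  have hFc : Continuous fun ω : ℝ =>
      (∑ i ∈ Finset.range N, ‖T ω‖ ^ (2 * i)) * ‖L ω‖ ^ 2 := by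
    fun_prop
  have hev := (hFc.tendsto 0).eventually_const_lt (u := c + 1)
    (by simpa [hT0] using hN)
  obtain ⟨δ, hδ, hball⟩ := Metric.nhds_basis_closedBall.eventually_iff.1 hev
  have hvol : (volume : Measure ℝ).real (Metric.closedBall 0 δ) = 2 * δ :=
    Real.volume_real_closedBall hδ.le
  have hms : MeasurableSet (Metric.closedBall (0 : ℝ) δ) := measurableSet_closedBall
  have hfin : (volume : Measure ℝ) (Metric.closedBall 0 δ) ≠ ⊤ := measure_closedBall_lt_top.ne
  have hn : ∀ ω : ℝ, ‖(Metric.closedBall (0 : ℝ) δ).indicator (fun _ => (1 : ℂ)) ω‖ ^ 2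
      = (Metric.closedBall (0 : ℝ) δ).indicator (fun _ => (1 : ℝ)) ω := by
    intro ω
    by_cases hω : ω ∈ Metric.closedBall (0 : ℝ) δ
    · rw [Set.indicator_of_mem hω, Set.indicator_of_mem hω]
      simp
    · rw [Set.indicator_of_notMem hω, Set.indicator_of_notMem hω]
      simp
  have hint : ∫ ω : ℝ, ‖(Metric.closedBall (0 : ℝ) δ).indicator (fun _ => (1 : ℂ)) ω‖ ^ 2
      = 2 * δ := by
    simp_rw [hn]
    rw [integral_indicator_const _ hms, hvol]
    simp
  refine ⟨N, (Metric.closedBall (0 : ℝ) δ).indicator (fun _ => (1 : ℂ)),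
    memLp_indicator_const 2 hms 1 (Or.inr hfin), by rw [hint]; positivity, ?_⟩
  rw [hint]
  have heq : (fun ω : ℝ => (∑ i ∈ Finset.range N, ‖T ω‖ ^ (2 * i)) * ‖L ω‖ ^ 2 *
      ‖(Metric.closedBall (0 : ℝ) δ).indicator (fun _ => (1 : ℂ)) ω‖ ^ 2)
      = (Metric.closedBall (0 : ℝ) δ).indicator
        (fun ω => (∑ i ∈ Finset.range N, ‖T ω‖ ^ (2 * i)) * ‖L ω‖ ^ 2) := by
    funext ω
    rw [hn]
    by_cases hω : ω ∈ Metric.closedBall (0 : ℝ) δ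
    · rw [Set.indicator_of_mem hω, Set.indicator_of_mem hω, mul_one]
    · rw [Set.indicator_of_notMem hω, Set.indicator_of_notMem hω, mul_zero]
  rw [heq, integral_indicator hms]
  have hge : ∫ _ω in Metric.closedBall (0 : ℝ) δ, (c + 1) ≤
      ∫ ω in Metric.closedBall (0 : ℝ) δ,
        (∑ i ∈ Finset.range N, ‖T ω‖ ^ (2 * i)) * ‖L ω‖ ^ 2 :=
    setIntegral_mono_on (integrableOn_const hfin)
      (hFc.continuousOn.integrableOn_compact (isCompact_closedBall 0 δ)) hms
      (fun x hx => (hball hx).le)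
  rw [setIntegral_const, hvol, smul_eq_mul] at hge
  nlinarith
end

section
/- Let T, L : ℝ → ℂ be measurable functions that are continuous at ω = 0, with |T(0)| = 1 and L(0) ≠ 0. Then for every c > 0 there exist N ∈ ℕ and a nonzero square-integrable function d : ℝ → ℂ such that ∫_ℝ ( Σ_{i=0}^{N−1} |T(ω)|^{2i} ) · |L(ω)|² · |d(ω)|² dω > c · ∫_ℝ |d(ω)|² dω. -/
open MeasureTheory Complex Finset

/-- Abstract core of the impossibility proofs of Theorems 1 and 3(a): if the
per-stage error-propagation gain `T` has modulus `1` at zero frequency and the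
leader-disturbance-to-first-error gain `L` is nonzero there (both continuous at
`0` and measurable), then the cumulative energy
`∫ (∑_{i=0}^{N-1} |T(ω)|^{2i}) |L(ω)|² |d(ω)|² dω` cannot be bounded by
`c ∫ |d(ω)|² dω` uniformly in the chain length `N` and the square-integrable
disturbance `d`: `(L₂, l₂)` string stability fails. -/
theorem string_instability_abstract_core
    (T L : ℝ → ℂ) (hTmeas : Measurable T) (hLmeas : Measurable L)
    (hTcont : ContinuousAt T 0) (hLcont : ContinuousAt L 0)
    (hT0 : ‖T 0‖ = 1) (hL0 : L 0 ≠ 0) :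
    ∀ c : ℝ, 0 < c → ∃ (N : ℕ) (d : ℝ → ℂ), MemLp d 2 (volume : Measure ℝ) ∧
      (0 < ∫ ω : ℝ, ‖d ω‖ ^ 2) ∧
      (∫ ω : ℝ, (∑ i ∈ Finset.range N, ‖T ω‖ ^ (2 * i)) *
          ‖L ω‖ ^ 2 * ‖d ω‖ ^ 2)
        > c * ∫ ω : ℝ, ‖d ω‖ ^ 2 := by
  intro c hc
  have hLpos : 0 < ‖L 0‖ ^ 2 := by positivity
  obtain ⟨N, hN⟩ := exists_nat_gt ((c + 1) / ‖L 0‖ ^ 2)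
  rw [div_lt_iff₀ hLpos] at hN
  set G : ℝ → ℝ := fun ω => (∑ i ∈ Finset.range N, ‖T ω‖ ^ (2 * i)) * ‖L ω‖ ^ 2 with hG
  have hGm : Measurable G := by
    have := hTmeas.norm
    have := hLmeas.norm
    simp only [hG]
    fun_prop
  have hGc : ContinuousAt G 0 := by
    have := hTcont.norm
    have := hLcont.norm
    simp only [hG]
    refine ContinuousAt.mul ?_ (hLcont.norm.pow 2)
    exact tendsto_finsetSum _ fun i _ => hTcont.norm.pow (2 * i)
  have hG0 : G 0 = N * ‖L 0‖ ^ 2 := by simp [hG, hT0]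
  obtain ⟨ε, hε, hball⟩ := Metric.continuousAt_iff.mp hGc 1 one_pos
  have hb : ∀ x ∈ Metric.ball (0 : ℝ) ε, |G x - G 0| < 1 := by
    intro x hx
    have := hball (Metric.mem_ball.mp hx)
    rwa [Real.dist_eq] at this
  have hlow : ∀ x ∈ Metric.ball (0 : ℝ) ε, G 0 - 1 ≤ G x := fun x hx => by
    have := (abs_lt.mp (hb x hx)).1
    linarith
  have hvol : volume.real (Metric.ball (0 : ℝ) ε) = 2 * ε := by
    rw [Measure.real, Real.volume_ball, ENNReal.toReal_ofReal (by positivity)]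
  have hfin : volume (Metric.ball (0 : ℝ) ε) ≠ ⊤ := measure_ball_lt_top.ne
  have hd : ∀ ω : ℝ, ‖(Metric.ball (0 : ℝ) ε).indicator (fun _ => (1 : ℂ)) ω‖ ^ 2
      = (Metric.ball (0 : ℝ) ε).indicator (fun _ => (1 : ℝ)) ω := by
    intro ω
    by_cases h : ω ∈ Metric.ball (0 : ℝ) ε <;> simp only [Set.indicator, h] <;> simp
  have hI : ∫ ω : ℝ, ‖(Metric.ball (0 : ℝ) ε).indicator (fun _ => (1 : ℂ)) ω‖ ^ 2 = 2 * ε := by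
    simp_rw [hd]
    rw [integral_indicator measurableSet_ball, setIntegral_const, hvol]
    simp
  refine ⟨N, (Metric.ball (0 : ℝ) ε).indicator (fun _ => (1 : ℂ)),
    memLp_indicator_const 2 measurableSet_ball 1 (Or.inr hfin), ?_, ?_⟩
  · rw [hI]; positivity
  · rw [hI]
    have hJ : (∫ ω : ℝ, (∑ i ∈ Finset.range N, ‖T ω‖ ^ (2 * i)) * ‖L ω‖ ^ 2 *
        ‖(Metric.ball (0 : ℝ) ε).indicator (fun _ => (1 : ℂ)) ω‖ ^ 2)
        = ∫ ω in Metric.ball (0 : ℝ) ε, G ω := by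
      rw [← integral_indicator measurableSet_ball]
      congr 1
      ext ω
      rw [hd]
      by_cases h : ω ∈ Metric.ball (0 : ℝ) ε <;> simp only [Set.indicator, h] <;> simp [hG]
    rw [hJ]
    have hint : IntegrableOn G (Metric.ball (0 : ℝ) ε) := by
      refine Measure.integrableOn_of_bounded (M := |G 0| + 1) hfin hGm.aestronglyMeasurable ?_
      refine (ae_restrict_iff' measurableSet_ball).mpr (Filter.Eventually.of_forall fun x hx => ?_)
      have h1 := hb x hx
      have h2 := abs_sub_abs_le_abs_sub (G x) (G 0)
      rw [Real.norm_eq_abs]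
      linarith
    have hge := setIntegral_mono_on (integrableOn_const hfin (C := G 0 - 1)) hint
      measurableSet_ball hlow
    rw [setIntegral_const, hvol, smul_eq_mul] at hge
    have : c < G 0 - 1 := by rw [hG0]; linarith
    nlinarith
end

section
/- Let k_P, k_D, k_I, h ∈ ℝ with k_I ≠ 0 and h ≠ 0. For ω ≠ 0 define K(ω) = k_P + i k_D ω + k_I/(i ω), D(ω) = −ω² + (1 + i h ω)K(ω), T(ω) = K(ω)/D(ω) and L(ω) = 1/D(ω). Then lim_{ω→0} |L(ω)|² / (1 − |T(ω)|²) = 1/(k_I² h²). -/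
open Complex Filter Topology

/-- Key limit in the proof of Theorem 2.  For the PID controller
`K(iω) = k_P + i k_D ω + k_I/(iω)` with `k_I ≠ 0` and headway `h ≠ 0`, setting
`D(ω) = -ω² + (1 + ihω)K(ω)`, `T = K/D` and `L = 1/D`, one has
`|L(ω)|²/(1 - |T(ω)|²) → 1/(k_I² h²)` as `ω → 0` (through nonzero values). -/
theorem pid_key_limit
    (kP kD kI h : ℝ) (hkI : kI ≠ 0) (hh : h ≠ 0)
    (K D T L : ℝ → ℂ)
    (hK : ∀ ω : ℝ, ω ≠ 0 → K ω = (kP : ℂ) + Complex.I * kD * ω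
      + (kI : ℂ) / (Complex.I * ω))
    (hD : ∀ ω : ℝ, ω ≠ 0 → D ω = -(ω : ℂ) ^ 2 + (1 + Complex.I * h * ω) * K ω)
    (hT : ∀ ω : ℝ, ω ≠ 0 → T ω = K ω / D ω)
    (hL : ∀ ω : ℝ, ω ≠ 0 → L ω = 1 / D ω) :
    Tendsto (fun ω : ℝ => ‖L ω‖ ^ 2 / (1 - ‖T ω‖ ^ 2))
      (𝓝[≠] 0) (𝓝 (1 / (kI ^ 2 * h ^ 2))) := by
  set g : ℝ → ℝ := fun ω => h ^ 2 * (ω ^ 2 * kP ^ 2 + (kD * ω ^ 2 - kI) ^ 2) + ω ^ 4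
      - 2 * ω ^ 2 * (kP - h * (kD * ω ^ 2 - kI)) with hg
  have hgc : Continuous g := by rw [hg]; fun_prop
  have hg0 : g 0 = kI ^ 2 * h ^ 2 := by simp only [hg]; ring
  have hpos : 0 < g 0 := by rw [hg0]; positivity
  have hgt : Tendsto g (𝓝[≠] 0) (𝓝 (kI ^ 2 * h ^ 2)) := by
    rw [← hg0]
    exact hgc.continuousAt.tendsto.mono_left nhdsWithin_le_nhds
  have hev : ∀ᶠ ω in 𝓝[≠] (0 : ℝ), 0 < g ω :=
    (hgc.continuousAt.eventually (lt_mem_nhds hpos)).filter_mono nhdsWithin_le_nhds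
  have key : ∀ ω : ℝ, ω ≠ 0 → ‖D ω‖ ^ 2 = ‖K ω‖ ^ 2 + g ω := by
    intro ω hω
    have hK' : K ω = ((kP : ℝ) : ℂ) + ((kD * ω - kI / ω : ℝ) : ℂ) * Complex.I := by
      have h1 : (ω : ℂ) ≠ 0 := by exact_mod_cast hω
      rw [hK ω hω]
      push_cast
      have h2 : (kI : ℂ) / (Complex.I * ω) = -(kI / ω * Complex.I) := by
        rw [div_eq_iff (mul_ne_zero Complex.I_ne_zero h1)]
        field_simp
        rw [Complex.I_sq]; ring
      rw [h2]; ring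
    have hD' : D ω = ((-ω ^ 2 + kP - h * ω * (kD * ω - kI / ω) : ℝ) : ℂ)
        + ((kD * ω - kI / ω + h * ω * kP : ℝ) : ℂ) * Complex.I := by
      rw [hD ω hω, hK']
      push_cast
      linear_combination ((h : ℂ) * ω * (kD * ω - kI / ω)) * Complex.I_sq
    rw [hD', hK', Complex.sq_norm, Complex.sq_norm, Complex.normSq_add_mul_I,
      Complex.normSq_add_mul_I]
    simp only [hg]
    field_simp
    ring
  have hlim : Tendsto (fun ω => 1 / g ω) (𝓝[≠] 0) (𝓝 (1 / (kI ^ 2 * h ^ 2))) :=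
    tendsto_const_nhds.div hgt (by positivity)
  refine hlim.congr' ?_
  filter_upwards [hev, self_mem_nhdsWithin] with ω hω hne
  have hne' : ω ≠ 0 := hne
  have hk := key ω hne'
  have hdpos : 0 < ‖D ω‖ ^ 2 := by rw [hk]; positivity
  rw [hL ω hne', hT ω hne', norm_div, norm_div, norm_one, div_pow, div_pow, one_pow,
    one_sub_div hdpos.ne', div_div_div_cancel_right₀ hdpos.ne', hk, add_sub_cancel_left]
end

section
/- Let K and S be rational functions with real coefficients, each proper (degree of numerator at most degree of denominator) and finite at s = 0, with K(0) ≠ 0 and S(0) ≠ 1. Define the rational function G = (K + s²·S)/(s² + K), and assume every pole of G has strictly negative real part. If there exists ω₀ ∈ ℝ with |G(iω₀)| < 1, then there exists ω₁ ∈ ℝ with |G(iω₁)| > 1. -/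
open Polynomial Complex

open Filter Topology Asymptotics Bornology in
/-- Polynomial core: `p / q = 1 + s² r / q` with `q` stable and `r(0) ≠ 0`. -/
lemma waterbed_core (p q r : ℝ[X]) (hp : p = q + X ^ 2 * r) (hdeg : p.degree ≤ q.degree)
    (hstab : ∀ z : ℂ, aeval z q = 0 → z.re < 0) (hr : r.eval 0 ≠ 0) :
    ∃ ω : ℝ, 1 < ‖(aeval (Complex.I * ω) p / aeval (Complex.I * ω) q : ℂ)‖ := by
  by_contra! hcon
  have hq : ∀ z : ℂ, 0 ≤ z.re → aeval z q ≠ 0 := fun z hz h => by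
    have := hstab z h
    linarith
  set f : ℂ → ℂ := fun z => aeval z p / aeval z q with hf
  set g : ℂ → ℂ := fun z => aeval z r / aeval z q with hg
  have hq0 : aeval (0 : ℂ) q ≠ 0 := hq 0 (by simp)
  have hfg : ∀ z : ℂ, 0 ≤ z.re → f z = 1 + z ^ 2 * g z := by
    intro z hz
    have := hq z hz
    simp only [hf, hg, hp, map_add, map_mul, map_pow, aeval_X]
    field_simp
  have hgc : ContinuousAt (fun z => (g z).re) 0 := by
    apply Complex.continuous_re.continuousAt.comp
    exact ContinuousAt.div (Polynomial.continuous_aeval r).continuousAt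
      (Polynomial.continuous_aeval q).continuousAt hq0
  have hqe : ∀ P : ℝ[X], aeval (0 : ℂ) P = ((P.eval 0 : ℝ) : ℂ) := by
    intro P
    have := Polynomial.aeval_algebraMap_apply ℂ (0 : ℝ) P
    simpa using this
  have hg0 : (g 0).re = r.eval 0 / q.eval 0 := by
    simp only [hg, hqe]
    rw [← Complex.ofReal_div, Complex.ofReal_re]
  have hq0' : q.eval 0 ≠ 0 := by
    intro h
    apply hq0
    rw [hqe, h]; simp
  have hc : r.eval 0 / q.eval 0 ≠ 0 := div_ne_zero hr hq0'
  rcases lt_or_gt_of_ne hc with hneg | hpos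
  · have hev : ∀ᶠ z in 𝓝 (0 : ℂ), (g z).re < 0 := hgc.eventually_lt_const (hg0.trans_lt hneg)
    have ht : Tendsto (fun x : ℝ => Complex.I * (x : ℂ)) (𝓝[>] 0) (𝓝 0) := by
      refine Tendsto.mono_left ?_ nhdsWithin_le_nhds
      exact Continuous.tendsto' (by fun_prop) _ _ (by simp)
    obtain ⟨x, hx, hx0⟩ := ((ht.eventually hev).and self_mem_nhdsWithin).exists
    have hx0 : 0 < x := hx0
    have h1 := hcon x
    have h2 := hfg (Complex.I * x) (by simp)
    have h3 : (f (Complex.I * x)).re = 1 - x ^ 2 * (g (Complex.I * x)).re := by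
      rw [h2, mul_pow, Complex.I_sq, ← Complex.ofReal_pow]
      simp [-Complex.ofReal_pow]
      ring
    have h4 := Complex.re_le_norm (f (Complex.I * x))
    have h5 : ‖f (Complex.I * x)‖ ≤ 1 := h1
    nlinarith [mul_pos (pow_pos hx0 2) (neg_pos.mpr hx)]
  · have hev : ∀ᶠ z in 𝓝 (0 : ℂ), 0 < (g z).re := hgc.eventually_const_lt (hpos.trans_eq hg0.symm)
    have ht : Tendsto (fun x : ℝ => (x : ℂ)) (𝓝[>] 0) (𝓝 0) := by
      refine Tendsto.mono_left ?_ nhdsWithin_le_nhds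
      exact Continuous.tendsto' (by fun_prop) _ _ (by simp)
    obtain ⟨x, hx, hx0⟩ := ((ht.eventually hev).and self_mem_nhdsWithin).exists
    have hx0 : 0 < x := hx0
    have h2 := hfg x (by simpa using hx0.le)
    have h3 : (f x).re = 1 + x ^ 2 * (g x).re := by
      rw [h2, ← Complex.ofReal_pow]
      simp [-Complex.ofReal_pow]
    have h4 := Complex.re_le_norm (f x)
    have hO : f =O[cobounded ℂ] (fun _ => (1 : ℝ)) := by
      have h := Polynomial.isBigO_cobounded_of_degree_le (P := p.map (algebraMap ℝ ℂ))
        (Q := q.map (algebraMap ℝ ℂ)) (by simpa only [degree_map] using hdeg)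
      obtain ⟨C, hC⟩ := h.bound
      refine IsBigO.of_bound (max C 0) ?_
      filter_upwards [hC] with z hz
      simp only [eval_map_algebraMap] at hz
      simp only [hf, norm_div, norm_one, mul_one]
      refine div_le_of_le_mul₀ (norm_nonneg _) (le_max_right _ _) (hz.trans ?_)
      gcongr
      exact le_max_left _ _
    have h5 : ‖f x‖ ≤ 1 := by
      refine PhragmenLindelof.right_half_plane_of_bounded_on_real (f := f) ?_ ?_ ?_ ?_
        (by simpa using hx0.le)
      · apply DifferentiableOn.diffContOnCl
        have hcl : closure {z : ℂ | 0 < z.re} = {z : ℂ | 0 ≤ z.re} := Complex.closure_setOfPred_lt_re 0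
        rw [hcl]
        intro z hz
        have hdiff : ∀ P : ℝ[X], DifferentiableAt ℂ (fun w : ℂ => aeval w P) z := fun P => by
          simp only [← eval_map_algebraMap]
          exact Polynomial.differentiableAt _
        exact ((hdiff p).fun_div (hdiff q) (hq z hz)).differentiableWithinAt
      · refine ⟨1, by norm_num, 0, ?_⟩
        simpa using hO.mono inf_le_left
      · have hT : Tendsto (fun x : ℝ => (x : ℂ)) atTop (cobounded ℂ) := by
          rw [← tendsto_norm_atTop_iff_cobounded]
          simpa using tendsto_abs_atTop_atTop
        have := hO.comp_tendsto hT
        exact this.isBoundedUnder_le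
      · intro y
        rw [mul_comm]
        exact hcon y
    nlinarith [mul_pos (pow_pos hx0 2) hx]

/-- Algebraic reduction. -/
lemma waterbed_alg (K S G : RatFunc ℝ)
    (hKproper : K.num.natDegree ≤ K.denom.natDegree)
    (hSproper : S.num.natDegree ≤ S.denom.natDegree)
    (hKfin : K.denom.eval 0 ≠ 0) (hSfin : S.denom.eval 0 ≠ 0)
    (hK0 : K.num.eval 0 ≠ 0) (hS0 : S.num.eval 0 ≠ S.denom.eval 0)
    (hG : G = (K + RatFunc.X ^ 2 * S) / (RatFunc.X ^ 2 + K))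
    (hq0 : G.denom.eval 0 ≠ 0) :
    G.num.degree ≤ G.denom.degree ∧
      ∃ r : ℝ[X], G.num = G.denom + X ^ 2 * r ∧ r.eval 0 ≠ 0 := by
  set a := K.num with ha
  set b := K.denom with hb
  set c := S.num with hc
  set d := S.denom with hd
  set q := G.denom with hq
  have hb0 : b ≠ 0 := RatFunc.denom_ne_zero K
  have hd0 : d ≠ 0 := RatFunc.denom_ne_zero S
  have he0 : X ^ 2 * b + a ≠ 0 := by
    intro h
    apply hK0
    have := congrArg (eval 0) h
    simpa using this
  have hD0 : d * (X ^ 2 * b + a) ≠ 0 := mul_ne_zero hd0 he0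
  have key : G.num * (d * (X ^ 2 * b + a)) = (a * d + X ^ 2 * c * b) * q := by
    rw [hq, RatFunc.num_mul_eq_mul_denom_iff hD0, hG]
    have inj : ∀ P : ℝ[X], P ≠ 0 → algebraMap ℝ[X] (RatFunc ℝ) P ≠ 0 := fun P hP =>
      RatFunc.algebraMap_ne_zero hP
    have h1 := inj _ hb0
    have h2 := inj _ hd0
    have h3 := inj _ he0
    rw [← RatFunc.num_div_denom K, ← RatFunc.num_div_denom S, ← ha, ← hb, ← hc, ← hd]
    simp only [map_add, map_mul, map_pow, RatFunc.algebraMap_X] at h3 ⊢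
    have h4 : RatFunc.X ^ 2 + algebraMap ℝ[X] (RatFunc ℝ) a / algebraMap ℝ[X] (RatFunc ℝ) b ≠ 0 := by
      intro h
      apply h3
      field_simp at h
      linear_combination h
    rw [div_eq_div_iff h4 (mul_ne_zero h2 h3)]
    field_simp
  constructor
  · by_cases hp : G.num = 0
    · rw [hp]; simp
    have hN0 : a * d + X ^ 2 * c * b ≠ 0 := by
      intro h
      rw [h, zero_mul] at key
      exact (mul_ne_zero hp hD0) key
    have hqne : q ≠ 0 := RatFunc.denom_ne_zero G
    have hX2 : (X ^ 2 * b : ℝ[X]).natDegree = b.natDegree + 2 := by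
      rw [natDegree_mul (pow_ne_zero 2 X_ne_zero) hb0, natDegree_X_pow]; ring
    have e1 : (X ^ 2 * b + a).natDegree = b.natDegree + 2 := by
      rw [natDegree_add_eq_left_of_natDegree_lt (by rw [hX2]; omega), hX2]
    have e2 : (a * d + X ^ 2 * c * b).natDegree ≤ d.natDegree + b.natDegree + 2 := by
      refine natDegree_add_le_of_degree_le ?_ ?_
      · refine natDegree_mul_le.trans ?_
        omega
      · refine natDegree_mul_le.trans ?_
        have := natDegree_mul_le (p := (X ^ 2 : ℝ[X])) (q := c)
        rw [natDegree_X_pow] at this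
        omega
    have e3 := congrArg natDegree key
    rw [natDegree_mul hp hD0, natDegree_mul hN0 hqne, natDegree_mul hd0 he0, e1] at e3
    rw [degree_eq_natDegree hp, degree_eq_natDegree hqne]
    exact_mod_cast (by omega : G.num.natDegree ≤ q.natDegree)
  · have key2 : (G.num - q) * (d * (X ^ 2 * b + a)) = X ^ 2 * (b * (c - d) * q) := by
      linear_combination key
    have hndvd : ¬ (X : ℝ[X]) ∣ d * (X ^ 2 * b + a) := by
      rw [X_dvd_iff, coeff_zero_eq_eval_zero]
      simp [hSfin, hK0]
    have hdvd : (X : ℝ[X]) ^ 2 ∣ G.num - q :=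
      prime_X.pow_dvd_of_dvd_mul_right 2 hndvd ⟨_, key2⟩
    obtain ⟨r, hr⟩ := hdvd
    refine ⟨r, by linear_combination hr, ?_⟩
    rw [hr, mul_assoc] at key2
    have key3 := mul_left_cancel₀ (pow_ne_zero 2 X_ne_zero) key2
    intro h0
    have := congrArg (eval 0) key3
    simp only [eval_mul, h0, zero_mul, eval_sub] at this
    exact (mul_ne_zero (mul_ne_zero hKfin (sub_ne_zero.mpr hS0)) hq0) this.symm

/-- Core of **Theorem 3(b)**.  With CACC-type communication and no time
headway, the nonzero eigenvalue of the error-propagation matrix is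
`G = (K + s² S)/(s² + K)` where `K` is the controller and `S = HW/B` collects
the communication transfer functions; Assumption 1 forbids `S(0) = 1`.  If `G`
has only stable poles and `|G(iω₀)| < 1` at some frequency, then
`|G(iω₁)| > 1` at some other frequency, so `L₂` string stability fails. -/
theorem theorem3b_cacc_waterbed
    (K S : RatFunc ℝ)
    (hKproper : K.num.natDegree ≤ K.denom.natDegree)
    (hSproper : S.num.natDegree ≤ S.denom.natDegree)
    (hKfin : K.denom.eval 0 ≠ 0) (hSfin : S.denom.eval 0 ≠ 0)
    (hK0 : K.num.eval 0 ≠ 0) (hS0 : S.num.eval 0 ≠ S.denom.eval 0)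
    (G : RatFunc ℝ)
    (hG : G = (K + RatFunc.X ^ 2 * S) / (RatFunc.X ^ 2 + K))
    (hstab : ∀ z : ℂ, aeval z G.denom = 0 → z.re < 0)
    (hlt : ∃ ω₀ : ℝ, ‖
      (aeval (Complex.I * ω₀) G.num / aeval (Complex.I * ω₀) G.denom : ℂ)‖ < 1) :
    ∃ ω₁ : ℝ, 1 < ‖
      (aeval (Complex.I * ω₁) G.num / aeval (Complex.I * ω₁) G.denom : ℂ)‖ := by
  have hq0 : G.denom.eval 0 ≠ 0 := by
    intro h
    have h1 := Polynomial.aeval_algebraMap_apply ℂ (0 : ℝ) G.denom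
    have h2 : aeval (0 : ℂ) G.denom = 0 := by simpa [h] using h1
    simpa using hstab 0 h2
  obtain ⟨hdeg, r, hr, hr0⟩ := waterbed_alg K S G hKproper hSproper hKfin hSfin hK0 hS0 hG hq0
  exact waterbed_core _ _ r hr hdeg hstab hr0
end

section
/- Let K^(r) = n_r/d_r, K^(f) = n_f/d_f and K = n/d be proper rational functions with real coefficients (each numerator/denominator pair coprime) with n_r(0), n_f(0), n(0), d_r(0), d_f(0), d(0) all nonzero. Assume every root of s²·d_r + n_r, every root of s²·d_f + n_f, and every root of q(s) = s²·(s²·d_f(s) + n_f(s))·d(s) + n_f(s)·n(s) has strictly negative real part. Define M^(r) = n_r/(s²d_r + n_r), M^(f) = n_f/(s²d_f + n_f) and A(s) = M^(r)(s)·K(s)/(s² + M^(f)(s)·K(s)). If there exists ω₀ ∈ ℝ with |A(iω₀)| < 1, then there exists ω₁ ∈ ℝ with |A(iω₁)| > 1. -/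
open Polynomial Complex

/-- A strictly proper stable rational function `P / Q` with `P / Q = 1 + O(s ^ 2)` at the origin
cannot be bounded by one on the imaginary axis. -/
lemma aux_stable_ratio (P Q : Polynomial ℝ) (hdeg : P.degree < Q.degree)
    (hQ : ∀ z : ℂ, aeval z Q = 0 → z.re < 0) (hdvd : X ^ 2 ∣ Q - P)
    (hle : ∀ ω : ℝ, ‖aeval (Complex.I * ω) P / aeval (Complex.I * ω) Q‖ ≤ 1) : False := by
  -- the maximum principle on the right half plane
  have hQne : ∀ z : ℂ, 0 ≤ z.re → aeval z Q ≠ 0 := fun z hz h => absurd (hQ z h) (not_lt.2 hz)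
  have hlo : (fun z : ℂ => aeval z P) =o[Bornology.cobounded ℂ] (fun z : ℂ => aeval z Q) := by
    have h := Polynomial.isLittleO_cobounded_of_degree_lt
      (P := P.map (algebraMap ℝ ℂ)) (Q := Q.map (algebraMap ℝ ℂ))
      (by simpa [Polynomial.degree_map] using hdeg)
    simpa [Polynomial.eval_map_algebraMap] using h
  have hlim : Filter.Tendsto (fun z : ℂ => aeval z P / aeval z Q) (Bornology.cobounded ℂ)
      (nhds 0) := hlo.tendsto_div_nhds_zero
  have hmax : ∀ z : ℂ, 0 ≤ z.re → ‖aeval z P / aeval z Q‖ ≤ 1 := by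
    intro z hz
    refine PhragmenLindelof.right_half_plane_of_tendsto_zero_on_real
      (f := fun z : ℂ => aeval z P / aeval z Q) ?_ ⟨1, by norm_num, 0, ?_⟩ ?_ ?_ hz
    · refine DifferentiableOn.diffContOnCl (fun w hw => ?_)
      rw [Complex.closure_setOfPred_lt_re] at hw
      exact ((P.differentiable_aeval w).div (Q.differentiable_aeval w)
        (hQne w hw)).differentiableWithinAt
    · have h1 := (hlim.isBigO_one ℝ).mono
        (inf_le_left (b := Filter.principal {z : ℂ | 0 < z.re}))
      simpa using h1
    · refine hlim.comp ?_
      rw [← tendsto_norm_atTop_iff_cobounded]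
      simpa using Filter.tendsto_abs_atTop_atTop
    · intro x
      have := hle x
      rwa [mul_comm] at this
  -- the local expansion at the origin
  obtain ⟨S, hS⟩ := hdvd
  have hS0 : S ≠ 0 := by
    rintro rfl
    rw [mul_zero, sub_eq_zero] at hS
    rw [hS] at hdeg
    exact lt_irrefl _ hdeg
  obtain ⟨R, hR, hRd⟩ := S.exists_eq_pow_rootMultiplicity_mul_and_not_dvd hS0 0
  generalize S.rootMultiplicity 0 = m at hR
  rw [C_0, sub_zero] at hR hRd
  rw [Polynomial.X_dvd_iff, Polynomial.coeff_zero_eq_eval_zero] at hRd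
  have hQP : ∀ z : ℂ, aeval z Q - aeval z P = z ^ (m + 2) * aeval z R := by
    intro z
    rw [← map_sub, hS, hR]
    simp only [map_mul, map_pow, aeval_X]
    ring
  have hev : ∀ T : Polynomial ℝ, aeval (0 : ℂ) T = ((T.eval 0 : ℝ) : ℂ) := by
    intro T
    have := Polynomial.aeval_algebraMap_apply ℂ (0 : ℝ) T
    simpa using this
  have hQ0 : Q.eval 0 ≠ 0 := by
    have := hQne 0 (by simp)
    rw [hev] at this
    exact_mod_cast this
  obtain ⟨s, hs, hsneg⟩ : ∃ s : ℂ, 0 ≤ s.re ∧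
      (s ^ (m + 2) * (aeval (0 : ℂ) R / aeval (0 : ℂ) Q)).re < 0 := by
    rw [hev, hev, ← Complex.ofReal_div]
    have hc : R.eval 0 / Q.eval 0 ≠ 0 := div_ne_zero hRd hQ0
    rcases lt_or_gt_of_ne hc with h | h
    · exact ⟨1, by simp, by simpa only [one_pow, one_mul, Complex.ofReal_re] using h⟩
    · refine ⟨Complex.exp (((Real.pi / (m + 2) : ℝ) : ℂ) * Complex.I), ?_, ?_⟩
      · rw [Complex.exp_ofReal_mul_I_re]
        apply Real.cos_nonneg_of_neg_pi_div_two_le_of_le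
        · have : 0 ≤ Real.pi / (m + 2) := by positivity
          linarith [Real.pi_pos]
        · apply div_le_div_of_nonneg_left Real.pi_pos.le (by norm_num)
          have : (0 : ℝ) ≤ m := Nat.cast_nonneg m
          linarith
      · have : Complex.exp (((Real.pi / (m + 2) : ℝ) : ℂ) * Complex.I) ^ (m + 2) = -1 := by
          rw [← Complex.exp_nat_mul, ← Complex.exp_pi_mul_I]
          congr 1
          have : (m : ℂ) + 2 ≠ 0 := by exact_mod_cast (by omega : m + 2 ≠ 0)
          push_cast
          field_simp
        rw [this, neg_one_mul, Complex.neg_re, Complex.ofReal_re]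
        linarith
  have hcont : ContinuousAt (fun t : ℝ =>
      (s ^ (m + 2) * (aeval ((t : ℂ) * s) R / aeval ((t : ℂ) * s) Q)).re) 0 := by
    have hts : ContinuousAt (fun t : ℝ => (t : ℂ) * s) 0 := by fun_prop
    have h1 : ∀ T : Polynomial ℝ, ContinuousAt (fun t : ℝ => aeval ((t : ℂ) * s) T) 0 :=
      fun T => (T.continuous_aeval (A := ℂ)).continuousAt.comp hts
    refine Complex.continuous_re.continuousAt.comp (continuousAt_const.mul ((h1 R).div (h1 Q) ?_))
    simpa using hQne 0 (by simp)
  have hev2 := hcont.eventually_lt (continuousAt_const (y := (0 : ℝ))) (by simpa using hsneg)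
  obtain ⟨ε, hε, hb⟩ := Metric.eventually_nhds_iff.1 hev2
  have hneg := @hb (ε / 2) (by rw [Real.dist_eq, sub_zero, abs_of_pos (by linarith)]; linarith)
  set t := ε / 2 with ht
  have htpos : 0 < t := by positivity
  have hre : 0 ≤ ((t : ℂ) * s).re := by
    rw [Complex.re_ofReal_mul]; positivity
  have hf : aeval ((t : ℂ) * s) P / aeval ((t : ℂ) * s) Q
      = 1 - ((t ^ (m + 2) : ℝ) : ℂ) *
        (s ^ (m + 2) * (aeval ((t : ℂ) * s) R / aeval ((t : ℂ) * s) Q)) := by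
    have h0 := hQne _ hre
    have h1 := hQP ((t : ℂ) * s)
    rw [div_eq_iff h0, sub_mul, one_mul, mul_assoc, mul_assoc, div_mul_cancel₀ _ h0]
    push_cast
    rw [mul_pow] at h1
    linear_combination -h1
  have h2 := hmax _ hre
  have h3 := (Complex.re_le_norm _).trans h2
  rw [hf, Complex.sub_re, Complex.one_re, Complex.re_ofReal_mul] at h3
  have h4 : 0 < t ^ (m + 2) := by positivity
  nlinarith [mul_neg_of_pos_of_neg h4 hneg]

/-- Degree of `X ^ 2 * a + b` for `b` of degree at most that of `a`. -/
lemma aux_natDegree (k : ℕ) (hk : 0 < k) (a b : Polynomial ℝ) (ha : a ≠ 0)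
    (h : b.natDegree ≤ a.natDegree) :
    (X ^ k * a + b).natDegree = a.natDegree + k := by
  have h1 : (X ^ k * a).natDegree = a.natDegree + k := Polynomial.natDegree_X_pow_mul k ha
  rw [Polynomial.natDegree_add_eq_left_of_natDegree_lt (by omega), h1]

/-- **Theorem 5**.  Vehicle chain with no time headway and no communication,
where distances are measured through sensor-mount dynamics
`M⁽ʳ⁾ = n_r/(s² d_r + n_r)`, `M⁽ᶠ⁾ = n_f/(s² d_f + n_f)` and the controller is
`K = n/d`.  Errors propagate as `eᵢ = A(s) e_{i-1}` with
`A = M⁽ʳ⁾ K / (s² + M⁽ᶠ⁾ K)`.  Under closed-loop stability (roots of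
`s² d_r + n_r`, `s² d_f + n_f` and `q = s²(s² d_f + n_f)d + n_f n` in the open
left half plane), if `|A(iω₀)| < 1` at some frequency then `|A(iω₁)| > 1` at
another: no tuning of the sensor-mount dynamics achieves `L₂` string
stability. -/
theorem theorem5_sensor_dynamics_instability
    (nr dr nf df n d : Polynomial ℝ)
    (hcopr : IsCoprime nr dr) (hcopf : IsCoprime nf df) (hcopK : IsCoprime n d)
    (hproperr : nr.natDegree ≤ dr.natDegree)
    (hproperf : nf.natDegree ≤ df.natDegree)
    (hproperK : n.natDegree ≤ d.natDegree)
    (hnr0 : nr.eval 0 ≠ 0) (hnf0 : nf.eval 0 ≠ 0) (hn0 : n.eval 0 ≠ 0)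
    (hdr0 : dr.eval 0 ≠ 0) (hdf0 : df.eval 0 ≠ 0) (hd0 : d.eval 0 ≠ 0)
    (hstabr : ∀ z : ℂ, aeval z (X ^ 2 * dr + nr) = 0 → z.re < 0)
    (hstabf : ∀ z : ℂ, aeval z (X ^ 2 * df + nf) = 0 → z.re < 0)
    (hstabq : ∀ z : ℂ,
      aeval z (X ^ 2 * (X ^ 2 * df + nf) * d + nf * n) = 0 → z.re < 0)
    (Mr Mf Kv A : ℝ → ℂ)
    (hMr : ∀ ω : ℝ, Mr ω = aeval (Complex.I * ω) nr
      / aeval (Complex.I * ω) (X ^ 2 * dr + nr))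
    (hMf : ∀ ω : ℝ, Mf ω = aeval (Complex.I * ω) nf
      / aeval (Complex.I * ω) (X ^ 2 * df + nf))
    (hKv : ∀ ω : ℝ, Kv ω = aeval (Complex.I * ω) n / aeval (Complex.I * ω) d)
    (hA : ∀ ω : ℝ, A ω = Mr ω * Kv ω / ((Complex.I * ω) ^ 2 + Mf ω * Kv ω))
    (hlt : ∃ ω₀ : ℝ, ‖A ω₀‖ < 1) :
    ∃ ω₁ : ℝ, 1 < ‖A ω₁‖ := by
  clear hlt
  by_contra hcon
  push Not at hcon
  have ne0 : ∀ p : Polynomial ℝ, p.eval 0 ≠ 0 → p ≠ 0 := by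
    rintro p hp rfl
    simp at hp
  set F : Polynomial ℝ := X ^ 2 * df + nf with hF
  set G : Polynomial ℝ := X ^ 2 * dr + nr with hG
  set q : Polynomial ℝ := X ^ 2 * F * d + nf * n with hq
  have hF0 : F ≠ 0 := ne0 _ (by simpa [hF] using hnf0)
  have hG0 : G ≠ 0 := ne0 _ (by simpa [hG] using hnr0)
  have hq0 : q ≠ 0 := ne0 _ (by simpa [hq] using ⟨hnf0, hn0⟩)
  have hFdeg : F.natDegree = df.natDegree + 2 := aux_natDegree 2 (by norm_num) _ _ (ne0 _ hdf0) hproperf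
  have hGdeg : G.natDegree = dr.natDegree + 2 := aux_natDegree 2 (by norm_num) _ _ (ne0 _ hdr0) hproperr
  have hFd : (F * d).natDegree = F.natDegree + d.natDegree :=
    Polynomial.natDegree_mul hF0 (ne0 _ hd0)
  have hnfn : (nf * n).natDegree = nf.natDegree + n.natDegree :=
    Polynomial.natDegree_mul (ne0 _ hnf0) (ne0 _ hn0)
  have hqdeg : q.natDegree = (F * d).natDegree + 2 := by
    rw [hq, mul_assoc]
    exact aux_natDegree 2 (by norm_num) _ _ (mul_ne_zero hF0 (ne0 _ hd0)) (by omega)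
  have hP0 : nr * n * F ≠ 0 := mul_ne_zero (mul_ne_zero (ne0 _ hnr0) (ne0 _ hn0)) hF0
  have hdeg : (nr * n * F).degree < (G * q).degree := by
    apply Polynomial.degree_lt_degree
    rw [Polynomial.natDegree_mul (mul_ne_zero (ne0 _ hnr0) (ne0 _ hn0)) hF0,
      Polynomial.natDegree_mul (ne0 _ hnr0) (ne0 _ hn0), Polynomial.natDegree_mul hG0 hq0]
    omega
  have hIre : ∀ ω : ℝ, ¬ ((Complex.I * (ω : ℂ)).re < 0) := by
    intro ω; simp
  have hGI : ∀ ω : ℝ, aeval (Complex.I * (ω : ℂ)) G ≠ 0 := fun ω h => hIre ω (hstabr _ h)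
  have hFI : ∀ ω : ℝ, aeval (Complex.I * (ω : ℂ)) F ≠ 0 := fun ω h => hIre ω (hstabf _ h)
  have hqI : ∀ ω : ℝ, aeval (Complex.I * (ω : ℂ)) q ≠ 0 := fun ω h => hIre ω (hstabq _ h)
  have hAeq : ∀ ω : ℝ, aeval (Complex.I * (ω : ℂ)) d ≠ 0 →
      A ω = aeval (Complex.I * (ω : ℂ)) (nr * n * F) / aeval (Complex.I * (ω : ℂ)) (G * q) := by
    intro ω hd
    have h1 := hGI ω
    have h2 := hFI ω
    have h3 := hqI ω
    have hqe : aeval (Complex.I * (ω : ℂ)) q = (Complex.I * (ω : ℂ)) ^ 2 *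
        aeval (Complex.I * (ω : ℂ)) F * aeval (Complex.I * (ω : ℂ)) d +
        aeval (Complex.I * (ω : ℂ)) nf * aeval (Complex.I * (ω : ℂ)) n := by
      rw [hq]; simp only [map_add, map_mul, map_pow, aeval_X]
    rw [hA, hMr, hMf, hKv, map_mul, map_mul, map_mul]
    generalize aeval (Complex.I * (ω : ℂ)) q = q' at *
    generalize aeval (Complex.I * (ω : ℂ)) F = F' at *
    generalize aeval (Complex.I * (ω : ℂ)) G = G' at *
    generalize aeval (Complex.I * (ω : ℂ)) d = d' at *
    generalize aeval (Complex.I * (ω : ℂ)) n = n' at *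
    generalize aeval (Complex.I * (ω : ℂ)) nf = f' at *
    generalize aeval (Complex.I * (ω : ℂ)) nr = r' at *
    generalize Complex.I * (ω : ℂ) = z at *
    have h4 : z ^ 2 + f' / F' * (n' / d') = q' / (F' * d') := by
      rw [hqe]; field_simp
    rw [h4]
    field_simp
  -- the exceptional frequencies are finitely many
  have hfin : {ω : ℝ | aeval (Complex.I * (ω : ℂ)) d = 0}.Finite := by
    have hinj : Function.Injective (fun ω : ℝ => Complex.I * (ω : ℂ)) := by
      intro a b h
      simpa using h
    have h1 : (d.rootSet ℂ).Finite := Polynomial.rootSet_finite d ℂ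
    refine (h1.preimage hinj.injOn).subset ?_
    intro ω hω
    exact (Polynomial.mem_rootSet).2 ⟨ne0 _ hd0, hω⟩
  refine aux_stable_ratio (nr * n * F) (G * q) hdeg ?_ ?_ ?_
  · intro z hz
    rw [map_mul, mul_eq_zero] at hz
    exact hz.elim (hstabr z) (hstabq z)
  · refine ⟨dr * q + nr * F * d - nr * n * df, ?_⟩
    rw [hq, hG, hF]
    ring
  · intro ω
    have hcont : Continuous (fun ω : ℝ => ‖aeval (Complex.I * (ω : ℂ)) (nr * n * F) /
        aeval (Complex.I * (ω : ℂ)) (G * q)‖) := by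
      have hz : Continuous (fun ω : ℝ => Complex.I * (ω : ℂ)) := by fun_prop
      refine (Continuous.div (((nr * n * F).continuous_aeval (A := ℂ)).comp hz)
        (((G * q).continuous_aeval (A := ℂ)).comp hz) ?_).norm
      intro ω
      rw [Function.comp_apply, map_mul]
      exact mul_ne_zero (hGI ω) (hqI ω)
    have hdense : Dense ({ω : ℝ | aeval (Complex.I * (ω : ℂ)) d = 0}ᶜ) := hfin.countable.dense_compl ℝ
    have hcl : IsClosed {ω : ℝ | ‖aeval (Complex.I * (ω : ℂ)) (nr * n * F) /
        aeval (Complex.I * (ω : ℂ)) (G * q)‖ ≤ 1} := isClosed_le hcont continuous_const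
    have hsub : ({ω : ℝ | aeval (Complex.I * (ω : ℂ)) d = 0}ᶜ) ⊆
        {ω : ℝ | ‖aeval (Complex.I * (ω : ℂ)) (nr * n * F) /
        aeval (Complex.I * (ω : ℂ)) (G * q)‖ ≤ 1} := by
      intro w hw
      have := hcon w
      rwa [hAeq w hw] at this
    exact hcl.closure_subset_iff.2 hsub (hdense ω)
end

section
/- Let h > 0 and let K, H, W, B : ℝ → ℂ be continuous functions with K(0) ≠ 0, B(0) ≠ 0, H(0)·W(0) ≠ B(0), B(ω) ≠ 0 for all ω ∈ ℝ, and Δ(ω) := −ω² + (1 + i h ω)·K(ω) ≠ 0 for all ω ∈ ℝ. For ω ∈ ℝ define the 2×2 complex matrix 𝐓(ω) with first row [ K(ω)/Δ(ω) , H(ω)W(ω)/Δ(ω) ] and second row [ −ω²·K(ω)/(B(ω)Δ(ω)) , −ω²·H(ω)W(ω)/(B(ω)Δ(ω)) ], and the vector z₁(ω) = (1/Δ(ω), −K(ω)/(B(ω)Δ(ω))) ∈ ℂ². Then for every c > 0 there exist N ∈ ℕ and a nonzero square-integrable function d₀ : ℝ → ℂ such that Σ_{i=1}^{N} ∫_ℝ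 |(𝐓(ω)^{i−1} z₁(ω))₁|² · |d₀(ω)|² dω > c · ∫_ℝ |d₀(ω)|² dω, where (·)₁ denotes the first component of a vector in ℂ². -/
open MeasureTheory Complex Matrix Finset

/-- **Theorem 3(a)** (frequency domain).  Vehicle chain with time headway
`h > 0` and CACC communication (`vᵢ = (K eᵢ + H rᵢ)/B`, `r_{i+1} = W vᵢ`),
with bounded nonzero DC controller gain (`K(0) ≠ 0` finite) and no perfect
channel matching (`H(0)W(0) ≠ B(0)`).  A leader disturbance `d₀` produces
states `zᵢ(iω) = 𝐓(iω)^{i-1} z₁(iω) d₀(iω)` whose first components are the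
spacing errors; then the ratio of the `(L₂, l₂)` norm squared of the errors to
`‖d₀‖²` is unbounded over `N` and `d₀`: `(L₂, l₂)` string stability fails. -/
theorem theorem3a_cacc_headway_instability
    (h : ℝ) (hh : 0 < h) (K H W B : ℝ → ℂ)
    (hKcont : Continuous K) (hHcont : Continuous H)
    (hWcont : Continuous W) (hBcont : Continuous B)
    (hK0 : K 0 ≠ 0) (hB0 : B 0 ≠ 0) (hHWB : H 0 * W 0 ≠ B 0)
    (hBne : ∀ ω : ℝ, B ω ≠ 0)
    (Δ : ℝ → ℂ)
    (hΔdef : ∀ ω : ℝ, Δ ω = -(ω : ℂ) ^ 2 + (1 + Complex.I * h * ω) * K ω)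
    (hΔne : ∀ ω : ℝ, Δ ω ≠ 0)
    (Tmat : ℝ → Matrix (Fin 2) (Fin 2) ℂ)
    (hTmat : ∀ ω : ℝ, Tmat ω = Matrix.of
      ![![ K ω / Δ ω, H ω * W ω / Δ ω],
         ![ -(ω : ℂ) ^ 2 * K ω / (B ω * Δ ω),
            -(ω : ℂ) ^ 2 * H ω * W ω / (B ω * Δ ω)]])
    (z₁ : ℝ → Fin 2 → ℂ)
    (hz₁ : ∀ ω : ℝ, z₁ ω = ![ 1 / Δ ω, -K ω / (B ω * Δ ω)]) :
    ∀ c : ℝ, 0 < c → ∃ (N : ℕ) (d₀ : ℝ → ℂ),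
      MemLp d₀ 2 (volume : Measure ℝ) ∧
      (0 < ∫ ω : ℝ, ‖d₀ ω‖ ^ 2) ∧
      (∑ i ∈ Finset.Icc 1 N, ∫ ω : ℝ,
          ‖((Tmat ω ^ (i - 1)).mulVec (z₁ ω)) 0‖ ^ 2
            * ‖d₀ ω‖ ^ 2)
        > c * ∫ ω : ℝ, ‖d₀ ω‖ ^ 2 := by
  intro c hc
  have hΔc : Continuous Δ := by
    rw [show Δ = fun ω : ℝ => -(ω : ℂ) ^ 2 + (1 + Complex.I * h * ω) * K ω from funext hΔdef]
    fun_prop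
  have hBΔ : ∀ ω, B ω * Δ ω ≠ 0 := fun ω => mul_ne_zero (hBne ω) (hΔne ω)
  have hTc : Continuous Tmat := by
    rw [show Tmat = _ from funext hTmat]
    refine continuous_matrix ?_
    intro i j
    fin_cases i <;> fin_cases j <;> simp <;> fun_prop (disch := assumption)
  have hzc : Continuous z₁ := by
    rw [show z₁ = _ from funext hz₁]
    refine continuous_pi ?_
    intro i
    fin_cases i <;> simp <;> fun_prop (disch := assumption)
  have hfc : ∀ n : ℕ, Continuous fun ω : ℝ => ‖((Tmat ω ^ n).mulVec (z₁ ω)) 0‖ ^ 2 := by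
    intro n
    have h1 : Continuous fun ω : ℝ => (Tmat ω ^ n).mulVec (z₁ ω) :=
      (hTc.pow n).matrix_mulVec hzc
    exact ((continuous_apply 0).comp h1).norm.pow 2
  have hΔ0 : Δ 0 = K 0 := by simp [hΔdef]
  set a : ℂ := (B 0 - H 0 * W 0) / (K 0 * B 0) with ha
  have ha0 : a ≠ 0 := div_ne_zero (sub_ne_zero.2 hHWB.symm) (mul_ne_zero hK0 hB0)
  have hval : ∀ n : ℕ, (Tmat 0 ^ (n + 1)).mulVec (z₁ 0) = ![a, 0] := by
    intro n
    induction n with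
    | zero =>
      rw [zero_add, pow_one, hTmat, hz₁, hΔ0, ha]
      ext i
      fin_cases i
      · simp [Matrix.mulVec, dotProduct, Fin.sum_univ_two]
        field_simp
        ring
      · simp [Matrix.mulVec, dotProduct, Fin.sum_univ_two]
    | succ n ih =>
      rw [pow_succ', ← Matrix.mulVec_mulVec, ih, hTmat, hΔ0]
      ext i
      fin_cases i
      · simp [Matrix.mulVec, dotProduct, Fin.sum_univ_two, hK0]
      · simp [Matrix.mulVec, dotProduct, Fin.sum_univ_two]
  have hapos : 0 < ‖a‖ ^ 2 := by positivity
  obtain ⟨M, hM⟩ := exists_nat_gt ((c + 1) / ‖a‖ ^ 2)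
  rw [div_lt_iff₀ hapos] at hM
  set g : ℝ → ℝ := fun ω => ∑ i ∈ Finset.Icc 1 (M + 1),
    ‖((Tmat ω ^ (i - 1)).mulVec (z₁ ω)) 0‖ ^ 2 with hg
  have hgc : Continuous g := continuous_finsetSum _ fun i _ => hfc (i - 1)
  have hg0 : c + 1 < g 0 := by
    refine hM.trans_le ?_
    have h2 : ∑ i ∈ Finset.Icc 2 (M + 1),
        ‖((Tmat 0 ^ (i - 1)).mulVec (z₁ 0)) 0‖ ^ 2 = M * ‖a‖ ^ 2 := by
      rw [Finset.sum_congr rfl (g := fun _ => ‖a‖ ^ 2)]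
      · simp
      · intro i hi
        obtain ⟨k, rfl⟩ := Nat.exists_eq_add_of_le (Finset.mem_Icc.1 hi).1
        rw [show 2 + k - 1 = k + 1 by omega, hval]
        simp
    rw [← h2]
    exact Finset.sum_le_sum_of_subset_of_nonneg
      (Finset.Icc_subset_Icc (by norm_num) le_rfl) (fun i _ _ => by positivity)
  obtain ⟨δ, hδ, hball⟩ := Metric.mem_nhds_iff.1
    (hgc.continuousAt.eventually (lt_mem_nhds hg0))
  set S : Set ℝ := Set.Icc 0 (δ / 2) with hS
  have hSm : MeasurableSet S := measurableSet_Icc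
  have hSv : volume.real S = δ / 2 := by
    simp [hS]
    positivity
  have hd : ∀ f : ℝ → ℝ, (∫ ω : ℝ, f ω * ‖S.indicator (fun _ => (1 : ℂ)) ω‖ ^ 2)
      = ∫ ω in S, f ω := by
    intro f
    rw [← integral_indicator hSm]
    congr 1
    ext ω
    by_cases hω : ω ∈ S <;> simp [hω]
  have hd1 : (∫ ω : ℝ, ‖S.indicator (fun _ => (1 : ℂ)) ω‖ ^ 2) = δ / 2 := by
    have := hd (fun _ => 1)
    simpa [hSv] using this
  have hint : ∀ f : ℝ → ℝ, Continuous f → IntegrableOn f S := fun f hf =>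
    hf.continuousOn.integrableOn_compact isCompact_Icc
  refine ⟨M + 1, S.indicator (fun _ => (1 : ℂ)), ?_, ?_, ?_⟩
  · exact memLp_indicator_const 2 hSm 1 (Or.inr (by simp [hS]))
  · rw [hd1]; positivity
  · rw [hd1]
    simp only [hd]
    rw [← integral_finsetSum _ (fun i _ => hint _ (hfc (i - 1)))]
    have h3 : ∫ ω in S, (c + 1) ≤ ∫ ω in S, g ω := by
      refine setIntegral_mono_on (hint _ continuous_const) (hint _ hgc) hSm ?_
      intro ω hω
      have : ω ∈ Metric.ball (0 : ℝ) δ := by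
        rw [Metric.mem_ball, Real.dist_eq, sub_zero, abs_of_nonneg hω.1]
        linarith [hω.2]
      exact (hball this).le
    rw [setIntegral_const, hSv, smul_eq_mul] at h3
    refine lt_of_lt_of_le ?_ h3
    nlinarith
end
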